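/- arXiv:1710.09765 — 6 statements merged into one kernel-verified Lean document; each statement's English description precedes it below -/
import Mathlib

section
/- Let Q = GR(a,b,c,d). Let u, v ∈ {1,…,N} and let λ ∈ ℤ⁴ satisfy λ₁, λ₂, λ₃, λ₄ ≥ 0 and a·λ₁ + b·λ₂ − c·λ₃ − d·λ₄ = v − u. Then there exists a path π in Q from u to v with wt(π) = λ. -/
/-- Weight vectors in `ℤ⁴`. -/
abbrev V4 : Type := Fin 4 → ℤ

/-- The eight possible types of arrows in a Gale–Robinson quiver. -/
inductive GRArrowType : Type
  | E | W | S | N | SE | NE | SW | NW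
  deriving DecidableEq

/-- The weight in `ℤ⁴` of each arrow type. -/
def GRwt : GRArrowType → V4
  | .E  => ![1, 0, 0, 0]
  | .W  => ![0, 1, 0, 0]
  | .S  => ![0, 0, 1, 0]
  | .N  => ![0, 0, 0, 1]
  | .SE => ![1, 0, 1, 0]
  | .NE => ![1, 0, 0, 1]
  | .SW => ![0, 1, 1, 0]
  | .NW => ![0, 1, 0, 1]

/-- `IsGRArrow a b c d N τ i j` : the Gale–Robinson quiver `GR(a,b,c,d)` (on vertex set
`{1,…,N}`) has an arrow of type `τ` from `i` to `j`. -/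
def IsGRArrow (a b c d N : ℤ) : GRArrowType → ℤ → ℤ → Prop
  | .E,  i, j => 1 ≤ i ∧ i ≤ N ∧ 1 ≤ j ∧ j ≤ N ∧ j = i + a
  | .W,  i, j => 1 ≤ i ∧ i ≤ N ∧ 1 ≤ j ∧ j ≤ N ∧ j = i + b
  | .S,  i, j => 1 ≤ i ∧ i ≤ N ∧ 1 ≤ j ∧ j ≤ N ∧ j = i - c
  | .N,  i, j => 1 ≤ i ∧ i ≤ N ∧ 1 ≤ j ∧ j ≤ N ∧ j = i - d
  | .SE, i, j => 1 ≤ i ∧ i ≤ N ∧ 1 ≤ j ∧ j ≤ N ∧ j = i + a - c ∧ N < i + a ∧ i - c < 1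
  | .NE, i, j => 1 ≤ i ∧ i ≤ N ∧ 1 ≤ j ∧ j ≤ N ∧ j = i + a - d ∧ N < i + a ∧ i - d < 1
  | .SW, i, j => 1 ≤ i ∧ i ≤ N ∧ 1 ≤ j ∧ j ≤ N ∧ j = i + b - c ∧ N < i + b ∧ i - c < 1
  | .NW, i, j => 1 ≤ i ∧ i ≤ N ∧ 1 ≤ j ∧ j ≤ N ∧ j = i + b - d ∧ N < i + b ∧ i - d < 1

/-- Paths in the Gale–Robinson quiver `GR(a,b,c,d)` (arrows are appended on the left,
`nil` is the lazy path at a vertex of `{1,…,N}`). -/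
inductive GRPath (a b c d N : ℤ) : ℤ → ℤ → Type
  | nil (i : ℤ) (h1 : 1 ≤ i) (h2 : i ≤ N) : GRPath a b c d N i i
  | cons {i j k : ℤ} (τ : GRArrowType) (h : IsGRArrow a b c d N τ j k)
      (p : GRPath a b c d N i j) : GRPath a b c d N i k

/-- The weight of a path: the sum in `ℤ⁴` of the weights of its arrows. -/
def GRPath.wt {a b c d N : ℤ} : {i j : ℤ} → GRPath a b c d N i j → V4
  | _, _, .nil _ _ _ => 0
  | _, _, .cons τ _ p => p.wt + GRwt τ

/-- The linear form `λ ↦ a·λ₁ + b·λ₂ − c·λ₃ − d·λ₄`. -/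
def linS (a b c d : ℤ) (l : V4) : ℤ := a * l 0 + b * l 1 - c * l 2 - d * l 3

theorem gr_aux (a b c d N : ℤ)
    (ha : 0 < a) (hb : 0 < b) (hc : 0 < c) (hd : 0 < d)
    (hab : a + b = N) (hcd : c + d = N)
    (u : ℤ) (hu1 : 1 ≤ u) (huN : u ≤ N) (n : ℕ) :
    ∀ (v : ℤ) (_ : 1 ≤ v) (_ : v ≤ N) (x y z w : ℤ) (_ : 0 ≤ x) (_ : 0 ≤ y) (_ : 0 ≤ z)
    (_ : 0 ≤ w) (_ : x + y + z + w ≤ n)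
    (_ : a * x + b * y - c * z - d * w = v - u),
    ∃ π : GRPath a b c d N u v, π.wt = ![x, y, z, w] := by
  induction n with
  | zero =>
    intro v hv1 hvN x y z w hx hy hz hw hn hl
    obtain rfl : x = 0 := by push_cast at hn; omega
    obtain rfl : y = 0 := by push_cast at hn; omega
    obtain rfl : z = 0 := by push_cast at hn; omega
    obtain rfl : w = 0 := by push_cast at hn; omega
    obtain rfl : u = v := by linarith
    refine ⟨.nil u hu1 huN, ?_⟩
    ext i; fin_cases i <;> simp [GRPath.wt]
  | succ n ih =>
    intro v hv1 hvN x y z w hx hy hz hw hn hl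
    push_cast at hn
    have step : ∀ (τ : GRArrowType) (j p q r s : ℤ), IsGRArrow a b c d N τ j v →
        GRwt τ = ![p, q, r, s] → 1 ≤ j → j ≤ N → 1 ≤ p + q + r + s →
        p ≤ x → q ≤ y → r ≤ z → s ≤ w → j = v - a * p - b * q + c * r + d * s →
        ∃ π : GRPath a b c d N u v, π.wt = ![x, y, z, w] := by
      intro τ j p q r s hτ hwt hj1 hjN h1 hp hq hr hs hj
      obtain ⟨π, hπ⟩ := ih j hj1 hjN (x - p) (y - q) (z - r) (w - s) (by omega) (by omega)
        (by omega) (by omega) (by omega) (by linarith)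
      refine ⟨.cons τ hτ π, ?_⟩
      rw [GRPath.wt, hπ, hwt]
      ext i; fin_cases i <;> simp
    have pos : ∀ k t : ℤ, 0 < k → 0 < t → k ≤ k * t := fun k t hk ht => by nlinarith
    have hax := mul_nonneg ha.le hx
    have hby := mul_nonneg hb.le hy
    have hcz := mul_nonneg hc.le hz
    have hdw := mul_nonneg hd.le hw
    by_cases hE : 0 < x ∧ 1 ≤ v - a
    · exact step .E (v - a) 1 0 0 0 (by simp only [IsGRArrow]; omega) rfl (by omega) (by omega)
        (by omega) (by omega) (by omega) (by omega) (by omega) (by ring)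
    by_cases hW : 0 < y ∧ 1 ≤ v - b
    · exact step .W (v - b) 0 1 0 0 (by simp only [IsGRArrow]; omega) rfl (by omega) (by omega)
        (by omega) (by omega) (by omega) (by omega) (by omega) (by ring)
    by_cases hS : 0 < z ∧ v + c ≤ N
    · exact step .S (v + c) 0 0 1 0 (by simp only [IsGRArrow]; omega) rfl (by omega) (by omega)
        (by omega) (by omega) (by omega) (by omega) (by omega) (by ring)
    by_cases hN : 0 < w ∧ v + d ≤ N
    · exact step .N (v + d) 0 0 0 1 (by simp only [IsGRArrow]; omega) rfl (by omega) (by omega)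
        (by omega) (by omega) (by omega) (by omega) (by omega) (by ring)
    by_cases hxz : 0 < x ∧ 0 < z
    · exact step .SE (v - a + c) 1 0 1 0 (by simp only [IsGRArrow]; omega) rfl (by omega)
        (by omega) (by omega) (by omega) (by omega) (by omega) (by omega) (by ring)
    by_cases hxw : 0 < x ∧ 0 < w
    · exact step .NE (v - a + d) 1 0 0 1 (by simp only [IsGRArrow]; omega) rfl (by omega)
        (by omega) (by omega) (by omega) (by omega) (by omega) (by omega) (by ring)
    by_cases hyz : 0 < y ∧ 0 < z
    · exact step .SW (v - b + c) 0 1 1 0 (by simp only [IsGRArrow]; omega) rfl (by omega)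
        (by omega) (by omega) (by omega) (by omega) (by omega) (by omega) (by ring)
    by_cases hyw : 0 < y ∧ 0 < w
    · exact step .NW (v - b + d) 0 1 0 1 (by simp only [IsGRArrow]; omega) rfl (by omega)
        (by omega) (by omega) (by omega) (by omega) (by omega) (by omega) (by ring)
    have hx0 : x = 0 := by
      by_contra h
      have := pos a x ha (by omega)
      obtain rfl : z = 0 := by omega
      obtain rfl : w = 0 := by omega
      have : ¬ 1 ≤ v - a := by omega
      linarith
    have hy0 : y = 0 := by
      by_contra h
      have := pos b y hb (by omega)
      obtain rfl : z = 0 := by omega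
      obtain rfl : w = 0 := by omega
      have : ¬ 1 ≤ v - b := by omega
      linarith
    subst hx0 hy0
    have hz0 : z = 0 := by
      by_contra h
      have := pos c z hc (by omega)
      have : ¬ v + c ≤ N := by omega
      linarith
    have hw0 : w = 0 := by
      by_contra h
      have := pos d w hd (by omega)
      have : ¬ v + d ≤ N := by omega
      linarith
    subst hz0 hw0
    exact ih v hv1 hvN 0 0 0 0 le_rfl le_rfl le_rfl le_rfl (by omega) hl

/-- If `u, v ∈ {1,…,N}` and `λ ∈ ℤ⁴` has all entries nonnegative with
`a·λ₁ + b·λ₂ − c·λ₃ − d·λ₄ = v − u`, then there is a path in `GR(a,b,c,d)` from `u` to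
`v` of weight `λ`. -/
theorem gr_exists_path_of_weight (a b c d N : ℤ)
    (ha : 0 < a) (hb : 0 < b) (hc : 0 < c) (hd : 0 < d)
    (hab : a + b = N) (hcd : c + d = N)
    (u v : ℤ) (hu1 : 1 ≤ u) (huN : u ≤ N) (hv1 : 1 ≤ v) (hvN : v ≤ N)
    (l : V4) (hpos : ∀ i, 0 ≤ l i)
    (hlin : a * l 0 + b * l 1 - c * l 2 - d * l 3 = v - u) :
    ∃ π : GRPath a b c d N u v, π.wt = l := by
  obtain ⟨π, hπ⟩ := gr_aux a b c d N ha hb hc hd hab hcd u hu1 huN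
    (l 0 + l 1 + l 2 + l 3).toNat v hv1 hvN (l 0) (l 1) (l 2) (l 3)
    (hpos 0) (hpos 1) (hpos 2) (hpos 3) (Int.self_le_toNat _) hlin
  refine ⟨π, hπ.trans ?_⟩
  ext i; fin_cases i <;> rfl
end

section
/- Let Q = GR(a,b,c,d), let t ∈ ℤ, and let S ⊆ X_t be finite. Then S is closed under intervals in X_t if and only if the following holds: for all vertices u, v, w of Q, every path π in Q from u to v, every path π' in Q from v to w, and every λ ∈ S with a·λ₁ + b·λ₂ − c·λ₃ − d·λ₄ = t + u, if λ + wt(π) + wt(π') ∈ S then λ + wt(π) ∈ S. (This is precisely the condition under which the calibrated action rule, sending f_λ to f_{λ+wt(π)} when λ + wt(π) lies in S and to 0 otherwise, is compatible with composition of paths and hence defines a module over the path algebra of Q.) -/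
/-- Membership in the poset `X_t = {λ ∈ ℤ⁴ : t+1 ≤ a·λ₁ + b·λ₂ − c·λ₃ − d·λ₄ ≤ t+N}`. -/
def InX (a b c d N t : ℤ) (l : V4) : Prop :=
  t + 1 ≤ linS a b c d l ∧ linS a b c d l ≤ t + N

/-- `S ⊆ X_t` is closed under intervals: for `x, z ∈ S` and `y ∈ X_t` with `x ≤ y ≤ z`
(componentwise), one has `y ∈ S`. -/
def IntervalClosed (a b c d N t : ℤ) (S : Set V4) : Prop :=
  ∀ x ∈ S, ∀ z ∈ S, ∀ y : V4, InX a b c d N t y → x ≤ y → y ≤ z → y ∈ S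

lemma GRwt_nonneg (τ : GRArrowType) : 0 ≤ GRwt τ := by
  intro k
  cases τ <;> fin_cases k <;> simp [GRwt]

lemma linS_add (a b c d : ℤ) (l m : V4) :
    linS a b c d (l + m) = linS a b c d l + linS a b c d m := by
  simp only [linS, Pi.add_apply]; ring

lemma arrow_lin {a b c d N : ℤ} {τ : GRArrowType} {i j : ℤ} (h : IsGRArrow a b c d N τ i j) :
    1 ≤ j ∧ j ≤ N ∧ linS a b c d (GRwt τ) = j - i := by
  cases τ <;> simp [IsGRArrow] at h <;> refine ⟨by omega, by omega, ?_⟩ <;>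
    simp [linS, GRwt] <;> omega

lemma path_facts {a b c d N : ℤ} {i j : ℤ} (p : GRPath a b c d N i j) :
    1 ≤ j ∧ j ≤ N ∧ linS a b c d p.wt = j - i ∧ 0 ≤ p.wt := by
  induction p with
  | nil h1 h2 => exact ⟨h1, h2, by simp [GRPath.wt, linS], by rw [GRPath.wt]⟩
  | cons τ h p ih =>
    obtain ⟨h1, h2, h3⟩ := arrow_lin h
    refine ⟨h1, h2, ?_, ?_⟩
    · simp only [GRPath.wt, linS_add]; omega
    · simp only [GRPath.wt]; exact add_nonneg ih.2.2.2 (GRwt_nonneg τ)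

lemma exists_step {a b c d N : ℤ} (ha : 0 < a) (hb : 0 < b) (hc : 0 < c) (hd : 0 < d)
    (hab : a + b = N) (hcd : c + d = N) (i : ℤ) (h1 : 1 ≤ i) (h2 : i ≤ N)
    (m : V4) (hm : 0 ≤ m) (hm0 : 0 < m 0 + m 1 + m 2 + m 3)
    (h3 : 1 ≤ i + linS a b c d m) (h4 : i + linS a b c d m ≤ N) :
    ∃ τ j, IsGRArrow a b c d N τ i j ∧ GRwt τ ≤ m := by
  have m0 := hm 0
  have m1 := hm 1
  have m2 := hm 2
  have m3 := hm 3
  simp only [Pi.zero_apply] at m0 m1 m2 m3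
  by_contra hcon
  push Not at hcon
  have key : ∀ τ, GRwt τ ≤ m ↔ (GRwt τ 0 ≤ m 0 ∧ GRwt τ 1 ≤ m 1 ∧ GRwt τ 2 ≤ m 2 ∧ GRwt τ 3 ≤ m 3) := by
    intro τ
    simp [Pi.le_def, Fin.forall_fin_succ]
  have hE := hcon .E (i + a)
  have hW := hcon .W (i + b)
  have hS := hcon .S (i - c)
  have hN := hcon .N (i - d)
  have hSE := hcon .SE (i + a - c)
  have hNE := hcon .NE (i + a - d)
  have hSW := hcon .SW (i + b - c)
  have hNW := hcon .NW (i + b - d)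
  simp only [key] at hE hW hS hN hSE hNE hSW hNW
  simp [GRwt, IsGRArrow] at hE hW hS hN hSE hNE hSW hNW
  unfold linS at h3 h4
  have pa : 0 ≤ a * m 0 := by positivity
  have pb : 0 ≤ b * m 1 := by positivity
  have pc : 0 ≤ c * m 2 := by positivity
  have pd : 0 ≤ d * m 3 := by positivity
  have qa : 1 ≤ m 0 → a ≤ a * m 0 := fun h => by nlinarith
  have qb : 1 ≤ m 1 → b ≤ b * m 1 := fun h => by nlinarith
  have qc : 1 ≤ m 2 → c ≤ c * m 2 := fun h => by nlinarith
  have qd : 1 ≤ m 3 → d ≤ d * m 3 := fun h => by nlinarith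
  have za : m 0 = 0 → a * m 0 = 0 := fun h => by rw [h, mul_zero]
  have zb : m 1 = 0 → b * m 1 = 0 := fun h => by rw [h, mul_zero]
  have zc : m 2 = 0 → c * m 2 = 0 := fun h => by rw [h, mul_zero]
  have zd : m 3 = 0 → d * m 3 = 0 := fun h => by rw [h, mul_zero]
  generalize a * m 0 = A at *
  generalize b * m 1 = B at *
  generalize c * m 2 = C at *
  generalize d * m 3 = D at *
  clear hcon key hm
  generalize m 0 = x0 at *
  generalize m 1 = x1 at *
  generalize m 2 = x2 at *
  generalize m 3 = x3 at *
  have fE : 0 < x0 → N < i + a := fun h => by clear hW hS hN hSE hNE hSW hNW; by_contra; omega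
  have fW : 0 < x1 → N < i + b := fun h => by clear hE hS hN hSE hNE hSW hNW; by_contra; omega
  have fS : 0 < x2 → i - c < 1 := fun h => by clear hE hW hN hSE hNE hSW hNW; by_contra; omega
  have fN : 0 < x3 → i - d < 1 := fun h => by clear hE hW hS hSE hNE hSW hNW; by_contra; omega
  clear hE hW hS hN
  have gSE : 0 < x0 → 0 < x2 → False := fun h h' => by
    clear hNE hSW hNW; have := fE h; have := fS h'; omega
  have gNE : 0 < x0 → 0 < x3 → False := fun h h' => by
    clear hSE hSW hNW; have := fE h; have := fN h'; omega
  have gSW : 0 < x1 → 0 < x2 → False := fun h h' => by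
    clear hNE hSE hNW; have := fW h; have := fS h'; omega
  have gNW : 0 < x1 → 0 < x3 → False := fun h h' => by
    clear hNE hSW hSE; have := fW h; have := fN h'; omega
  clear hSE hNE hSW hNW
  rcases m0.eq_or_lt with e0 | e0
  · have := za e0.symm
    rcases m1.eq_or_lt with e1 | e1
    · have := zb e1.symm
      rcases m2.eq_or_lt with e2 | e2
      · have := fN (by omega)
        have := zc e2.symm
        have := qd (by omega)
        omega
      · have := fS e2
        have := qc e2
        omega
    · have := fW e1
      have := qb e1
      have := zc (by by_contra; exact gSW e1 (by omega))
      have := zd (by by_contra; exact gNW e1 (by omega))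
      omega
  · have := fE e0
    have := qa e0
    have := zc (by by_contra; exact gSE e0 (by omega))
    have := zd (by by_contra; exact gNE e0 (by omega))
    omega

lemma exists_path {a b c d N : ℤ} (ha : 0 < a) (hb : 0 < b) (hc : 0 < c) (hd : 0 < d)
    (hab : a + b = N) (hcd : c + d = N) (n : ℕ) :
    ∀ (u i : ℤ) (p : GRPath a b c d N u i) (m : V4), 0 ≤ m →
      m 0 + m 1 + m 2 + m 3 ≤ n → 
      1 ≤ i + linS a b c d m → i + linS a b c d m ≤ N →
      ∃ q : GRPath a b c d N u (i + linS a b c d m), q.wt = p.wt + m := by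
  induction n with
  | zero =>
    intro u i p m hm hs h1 h2
    have m0 := hm 0
    have m1 := hm 1
    have m2 := hm 2
    have m3 := hm 3
    simp only [Pi.zero_apply] at m0 m1 m2 m3
    have : m = 0 := by
      ext k; fin_cases k <;> simp <;> push_cast at hs <;> omega
    subst this
    have e : i + linS a b c d 0 = i := by simp [linS]
    rw [e]
    exact ⟨p, by simp⟩
  | succ n ih =>
    intro u i p m hm hs h1 h2
    by_cases h0 : 0 < m 0 + m 1 + m 2 + m 3
    · obtain ⟨hi1, hi2, -, -⟩ := path_facts p
      obtain ⟨τ, j, hτ, hle⟩ := exists_step ha hb hc hd hab hcd i hi1 hi2 m hm h0 h1 h2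
      have hl := (arrow_lin hτ).2.2
      have hm' : m = GRwt τ + (m - GRwt τ) := by abel
      have e : i + linS a b c d m = j + linS a b c d (m - GRwt τ) := by
        conv_lhs => rw [hm', linS_add, hl]
        ring
      rw [e] at h1 h2 ⊢
      obtain ⟨q, hq⟩ := ih u j (.cons τ hτ p) (m - GRwt τ) (sub_nonneg.2 hle) (by
        have : 1 ≤ GRwt τ 0 + GRwt τ 1 + GRwt τ 2 + GRwt τ 3 := by
          cases τ <;> simp [GRwt]
        simp only [Pi.sub_apply]; push_cast at hs; omega) h1 h2
      exact ⟨q, by rw [hq, GRPath.wt]; abel⟩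
    · exact ih u i p m hm (by omega) h1 h2

/-- A finite `S ⊆ X_t` is closed under intervals iff for all vertices
`u, v, w`, all paths `π : u → v` and `π' : v → w` in `GR(a,b,c,d)`, and all `λ ∈ S` with
`a·λ₁ + b·λ₂ − c·λ₃ − d·λ₄ = t + u`, if `λ + wt π + wt π' ∈ S` then `λ + wt π ∈ S`. -/
theorem intervalClosed_iff_path_action_compatible (a b c d N t : ℤ)
    (ha : 0 < a) (hb : 0 < b) (hc : 0 < c) (hd : 0 < d)
    (hab : a + b = N) (hcd : c + d = N)
    (S : Set V4) (hSX : ∀ l ∈ S, InX a b c d N t l) (hfin : S.Finite) :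
    IntervalClosed a b c d N t S ↔
      ∀ (u v w : ℤ) (π : GRPath a b c d N u v) (π' : GRPath a b c d N v w) (l : V4),
        l ∈ S → linS a b c d l = t + u →
        l + π.wt + π'.wt ∈ S → l + π.wt ∈ S := by
  constructor
  · intro H u v w π π' l hl hlu hz
    obtain ⟨h1, h2, h3, h4⟩ := path_facts π
    obtain ⟨-, -, -, h5⟩ := path_facts π'
    refine H l hl _ hz _ ?_ (le_add_of_nonneg_right h4) (le_add_of_nonneg_right h5)
    unfold InX
    rw [linS_add]
    constructor <;> omega
  · intro H x hx z hz y hy hxy hyz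
    have conn : ∀ x y : V4, InX a b c d N t x → InX a b c d N t y → x ≤ y →
        ∃ q : GRPath a b c d N (linS a b c d x - t) (linS a b c d y - t), q.wt = y - x := by
      intro x y hx hy hxy
      unfold InX at hx hy
      have e : linS a b c d y - t = linS a b c d x - t + linS a b c d (y - x) := by
        have : y = x + (y - x) := by abel
        conv_lhs => rw [this, linS_add]
        ring
      rw [e]
      obtain ⟨q, hq⟩ := exists_path ha hb hc hd hab hcd
        ((y - x) 0 + (y - x) 1 + (y - x) 2 + (y - x) 3).toNat _ _
        (.nil (linS a b c d x - t) (by omega) (by omega)) (y - x) (sub_nonneg.2 hxy)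
        (Int.self_le_toNat _) (by omega) (by omega)
      exact ⟨q, by rw [hq, GRPath.wt, zero_add]⟩
    obtain ⟨π, hπ⟩ := conn x y (hSX x hx) hy hxy
    obtain ⟨π', hπ'⟩ := conn y z hy (hSX z hz) hyz
    have := H _ _ _ π π' x hx (by ring) (by rw [hπ, hπ']; simpa using hz)
    rw [hπ] at this
    simpa using this
end

section
/- Let a, b, c, d, N be positive integers with a + b = N = c + d, gcd(a, c, N) = 1, and {a, b} ≠ {c, d}. Let x : ℤ → ℚ be a sequence satisfying x_i = 1 for 1 ≤ i ≤ N, x_i ≠ 0 for all i ∈ ℤ, and the Gale–Robinson recurrence x_i · x_{i+N} = x_{i+a} · x_{i+N−a} + x_{i+c} · x_{i+N−c} for all i ∈ ℤ. Then for every integer j > 0, x_{N+j} equals the number of order ideals of the finite poset S^{(j)}. -/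
/-- The poset `S^{(j)} = {λ ∈ ℤ⁴ : j−N ≤ a·λ₁ + b·λ₂ − c·λ₃ − d·λ₄ ≤ j−1,
λ₁ ≥ 0, λ₂ ≥ 0, λ₃ ≤ 0, λ₄ ≤ 0}`, ordered componentwise. -/
def Sj (a b c d N j : ℤ) : Set V4 :=
  {l | j - N ≤ linS a b c d l ∧ linS a b c d l ≤ j - 1 ∧
       0 ≤ l 0 ∧ 0 ≤ l 1 ∧ l 2 ≤ 0 ∧ l 3 ≤ 0}

namespace GR
open Finset
set_option linter.all false

noncomputable def slab (a b c d s e : ℤ) : Finset V4 :=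
  (Finset.Icc (![0, 0, -e, -e] : V4) ![e, e, 0, 0]).filter
    (fun l => s ≤ linS a b c d l ∧ linS a b c d l ≤ e)

def Orth (l : V4) : Prop := 0 ≤ l 0 ∧ 0 ≤ l 1 ∧ l 2 ≤ 0 ∧ l 3 ≤ 0

lemma le_iff (l m : V4) : l ≤ m ↔ l 0 ≤ m 0 ∧ l 1 ≤ m 1 ∧ l 2 ≤ m 2 ∧ l 3 ≤ m 3 := by
  simp [Pi.le_def, Fin.forall_fin_succ]

lemma mem_slab {a b c d s e : ℤ} (ha : 0 < a) (hb : 0 < b) (hc : 0 < c) (hd : 0 < d) (l : V4) :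
    l ∈ slab a b c d s e ↔ s ≤ linS a b c d l ∧ linS a b c d l ≤ e ∧ Orth l := by
  simp only [slab, mem_filter, mem_Icc, le_iff, Orth]
  simp only [Matrix.cons_val]
  constructor
  · tauto
  · rintro ⟨h1, h2, h3, h4, h5, h6⟩
    have h2' := h2
    unfold linS at h2'
    have a1 : l 0 ≤ a * l 0 := by nlinarith
    have a2 : l 1 ≤ b * l 1 := by nlinarith
    have a3 : -l 2 ≤ -(c * l 2) := by nlinarith
    have a4 : -l 3 ≤ -(d * l 3) := by nlinarith
    refine ⟨⟨⟨h3, h4, by linarith, by linarith⟩, by linarith, by linarith, h5, h6⟩, h1, h2⟩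

open Classical in
noncomputable def Ideals (S : Finset V4) : Finset (Finset V4) :=
  S.powerset.filter (fun I => ∀ m ∈ I, ∀ l ∈ S, l ≤ m → l ∈ I)

lemma mem_Ideals {S I : Finset V4} :
    I ∈ Ideals S ↔ I ⊆ S ∧ ∀ m ∈ I, ∀ l ∈ S, l ≤ m → l ∈ I := by
  simp [Ideals]

/-- Sum over an interval of finsets. -/
lemma sum_interval (A U : Finset V4) (h : A ⊆ U) (η : ℚ) :
    ∑ K ∈ U.powerset.filter (fun K => A ⊆ K), η ^ K.card
      = η ^ A.card * (1 + η) ^ (U.card - A.card) := by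
  have h1 : ∑ K ∈ U.powerset.filter (fun K => A ⊆ K), η ^ K.card
      = ∑ K ∈ (U \ A).powerset, η ^ A.card * η ^ K.card := by
    refine Finset.sum_bij' (fun K _ => K \ A) (fun K _ => A ∪ K) ?_ ?_ ?_ ?_ ?_
    · intro K hK
      simp only [mem_filter, mem_powerset] at hK ⊢
      exact sdiff_subset_sdiff hK.1 (subset_refl _)
    · intro K hK
      simp only [mem_filter, mem_powerset] at hK ⊢
      exact ⟨union_subset h (hK.trans sdiff_subset), subset_union_left⟩
    · intro K hK
      simp only [mem_filter, mem_powerset] at hK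
      exact union_sdiff_of_subset hK.2
    · intro K hK
      simp only [mem_powerset] at hK
      ext z
      have := @hK z
      simp only [mem_sdiff, mem_union] at this ⊢
      tauto
    · intro K hK
      simp only [mem_filter, mem_powerset] at hK
      rw [← pow_add, card_sdiff_of_subset hK.2, Nat.add_sub_cancel' (card_le_card hK.2)]
  rw [h1, ← Finset.mul_sum, ← card_sdiff_of_subset h]
  have := Finset.sum_pow_mul_eq_add_pow η 1 (U \ A)
  simp only [one_pow, mul_one] at this
  rw [this, add_comm]

lemma ext_sum (M T : Finset V4) (hMT : Disjoint M T) (A U : Finset V4 → Finset V4)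
    (hAU : ∀ I ∈ Ideals M, A I ⊆ U I) (hUT : ∀ I, U I ⊆ T)
    (hI : ∀ I K, I ⊆ M → K ⊆ T →
      (I ∪ K ∈ Ideals (M ∪ T) ↔ I ∈ Ideals M ∧ A I ⊆ K ∧ K ⊆ U I))
    (y : V4 → ℚ) (η : ℚ) (hy : ∀ l ∈ T, y l = η) :
    ∑ I ∈ Ideals (M ∪ T), ∏ l ∈ I, y l
      = ∑ I ∈ Ideals M, (∏ l ∈ I, y l) * (η ^ (A I).card * (1 + η) ^ ((U I).card - (A I).card)) := by
  have h1 : ∑ I ∈ Ideals M,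
      (∏ l ∈ I, y l) * (η ^ (A I).card * (1 + η) ^ ((U I).card - (A I).card))
      = ∑ I ∈ Ideals M, ∑ K ∈ (U I).powerset.filter (fun K => A I ⊆ K),
        (∏ l ∈ I, y l) * η ^ K.card := by
    refine Finset.sum_congr rfl fun I hI' => ?_
    rw [← sum_interval _ _ (hAU I hI'), Finset.mul_sum]
  rw [h1, Finset.sum_sigma']
  refine Finset.sum_bij' (fun I _ => (⟨I ∩ M, I ∩ T⟩ : (_ : Finset V4) × Finset V4))
    (fun p _ => p.1 ∪ p.2) ?_ ?_ ?_ ?_ ?_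
  · intro I h
    have hs := (mem_Ideals.1 h).1
    have e : I ∩ M ∪ I ∩ T = I := by rw [← inter_union_distrib_left]; exact inter_eq_left.2 hs
    have := (hI (I ∩ M) (I ∩ T) inter_subset_right inter_subset_right).1 (by rw [e]; exact h)
    simp only [mem_sigma, mem_filter, mem_powerset]
    exact ⟨this.1, this.2.2, this.2.1⟩
  · rintro ⟨I, K⟩ h
    simp only [mem_sigma, mem_filter, mem_powerset] at h
    exact (hI I K (mem_Ideals.1 h.1).1 (h.2.1.trans (hUT I))).2 ⟨h.1, h.2.2, h.2.1⟩
  · intro I h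
    have hs := (mem_Ideals.1 h).1
    show I ∩ M ∪ I ∩ T = I
    rw [← inter_union_distrib_left]; exact inter_eq_left.2 hs
  · rintro ⟨I, K⟩ h
    simp only [mem_sigma, mem_filter, mem_powerset] at h
    have hIM := (mem_Ideals.1 h.1).1
    have hKT := (h.2.1.trans (hUT I))
    have hd := Finset.disjoint_left.1 hMT
    have e1 : (I ∪ K) ∩ M = I := by
      ext z; have := @hIM z; have := @hKT z; have := @hd z
      simp only [mem_inter, mem_union]; tauto
    have e2 : (I ∪ K) ∩ T = K := by
      ext z; have := @hIM z; have := @hKT z; have := @hd z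
      simp only [mem_inter, mem_union]; tauto
    simp only [e1, e2]
  · intro I h
    have hs := (mem_Ideals.1 h).1
    have e : I ∩ M ∪ I ∩ T = I := by rw [← inter_union_distrib_left]; exact inter_eq_left.2 hs
    have hdis : Disjoint (I ∩ M) (I ∩ T) := hMT.mono inter_subset_right inter_subset_right
    conv_lhs => rw [← e]
    rw [Finset.prod_union hdis]
    congr 1
    rw [Finset.prod_congr rfl (g := fun _ => η) (fun l hl => hy l (mem_inter.1 hl).2)]
    simp

def e1 : V4 := ![1, 0, 0, 0]
def e2 : V4 := ![0, 1, 0, 0]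
def e3 : V4 := ![0, 0, 1, 0]
def e4 : V4 := ![0, 0, 0, 1]

@[simp] lemma e1_0 : e1 0 = 1 := rfl
@[simp] lemma e1_1 : e1 1 = 0 := rfl
@[simp] lemma e1_2 : e1 2 = 0 := rfl
@[simp] lemma e1_3 : e1 3 = 0 := rfl
@[simp] lemma e2_0 : e2 0 = 0 := rfl
@[simp] lemma e2_1 : e2 1 = 1 := rfl
@[simp] lemma e2_2 : e2 2 = 0 := rfl
@[simp] lemma e2_3 : e2 3 = 0 := rfl
@[simp] lemma e3_0 : e3 0 = 0 := rfl
@[simp] lemma e3_1 : e3 1 = 0 := rfl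
@[simp] lemma e3_2 : e3 2 = 1 := rfl
@[simp] lemma e3_3 : e3 3 = 0 := rfl
@[simp] lemma e4_0 : e4 0 = 0 := rfl
@[simp] lemma e4_1 : e4 1 = 0 := rfl
@[simp] lemma e4_2 : e4 2 = 0 := rfl
@[simp] lemma e4_3 : e4 3 = 1 := rfl

lemma linS_add (a b c d : ℤ) (l m : V4) : linS a b c d (l + m) = linS a b c d l + linS a b c d m := by
  simp [linS]; ring
lemma linS_sub (a b c d : ℤ) (l m : V4) : linS a b c d (l - m) = linS a b c d l - linS a b c d m := by
  simp [linS]; ring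
@[simp] lemma linS_e1 (a b c d : ℤ) : linS a b c d e1 = a := by simp [linS]
@[simp] lemma linS_e2 (a b c d : ℤ) : linS a b c d e2 = b := by simp [linS]
@[simp] lemma linS_e3 (a b c d : ℤ) : linS a b c d e3 = -c := by simp [linS]
@[simp] lemma linS_e4 (a b c d : ℤ) : linS a b c d e4 = -d := by simp [linS]

section
variable {a b c d N : ℤ}

/-- If `l ≤ m` and `f m < f l`, or `f m = f l` and `l ≠ m`, a negative direction is used. -/
lemma dir_neg (ha : 0 < a) (hb : 0 < b) {l m : V4} (h : l ≤ m)
    (hf : linS a b c d m ≤ linS a b c d l) (hne : l ≠ m) :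
    l + e3 ≤ m ∨ l + e4 ≤ m := by
  simp only [le_iff, Pi.add_apply, e3_0, e3_1, e3_2, e3_3, e4_0, e4_1, e4_2, e4_3] at h ⊢
  by_contra hcon
  have h2 : m 2 = l 2 := by omega
  have h3 : m 3 = l 3 := by omega
  unfold linS at hf
  rw [h2, h3] at hf
  have q0 : 0 ≤ a * (m 0 - l 0) := mul_nonneg ha.le (by linarith)
  have q1 : 0 ≤ b * (m 1 - l 1) := mul_nonneg hb.le (by linarith)
  have p0 : a * (m 0 - l 0) = 0 := by nlinarith
  have p1 : b * (m 1 - l 1) = 0 := by nlinarith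
  have r0 : m 0 - l 0 = 0 := by
    rcases mul_eq_zero.1 p0 with h | h
    · omega
    · exact h
  have r1 : m 1 - l 1 = 0 := by
    rcases mul_eq_zero.1 p1 with h | h
    · omega
    · exact h
  apply hne
  funext i
  fin_cases i <;> simp <;> omega

lemma dir_pos (hc : 0 < c) (hd : 0 < d) {l m : V4} (h : l ≤ m)
    (hf : linS a b c d l ≤ linS a b c d m) (hne : l ≠ m) :
    l + e1 ≤ m ∨ l + e2 ≤ m := by
  simp only [le_iff, Pi.add_apply, e1_0, e1_1, e1_2, e1_3, e2_0, e2_1, e2_2, e2_3] at h ⊢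
  by_contra hcon
  have h2 : m 0 = l 0 := by omega
  have h3 : m 1 = l 1 := by omega
  unfold linS at hf
  rw [h2, h3] at hf
  have q0 : 0 ≤ c * (m 2 - l 2) := mul_nonneg hc.le (by linarith)
  have q1 : 0 ≤ d * (m 3 - l 3) := mul_nonneg hd.le (by linarith)
  have p0 : c * (m 2 - l 2) = 0 := by nlinarith
  have p1 : d * (m 3 - l 3) = 0 := by nlinarith
  have r0 : m 2 - l 2 = 0 := by
    rcases mul_eq_zero.1 p0 with h | h
    · omega
    · exact h
  have r1 : m 3 - l 3 = 0 := by
    rcases mul_eq_zero.1 p1 with h | h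
    · omega
    · exact h
  apply hne
  funext i
  fin_cases i <;> simp <;> omega

end
end GR

namespace GR
open Finset
set_option linter.all false

section
variable {a b c d N : ℤ}

noncomputable def Tin (a b c d t : ℤ) (I : Finset V4) : Finset V4 :=
  (slab a b c d t t).filter (fun l => l + e3 ∈ I ∨ l + e4 ∈ I)
noncomputable def TU (a b c d t : ℤ) (I : Finset V4) : Finset V4 :=
  (slab a b c d t t).filter (fun l => (1 ≤ l 0 → l - e1 ∈ I) ∧ (1 ≤ l 1 → l - e2 ∈ I))
noncomputable def Bin (a b c d t : ℤ) (I : Finset V4) : Finset V4 :=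
  (slab a b c d t t).filter (fun l => l + e1 ∈ I ∨ l + e2 ∈ I)
noncomputable def BU (a b c d t : ℤ) (I : Finset V4) : Finset V4 :=
  (slab a b c d t t).filter (fun l => l - e3 ∈ I ∧ l - e4 ∈ I)

lemma le_add_e (l : V4) : l ≤ l + e1 ∧ l ≤ l + e2 ∧ l ≤ l + e3 ∧ l ≤ l + e4 := by
  simp [le_iff]
lemma sub_e_le (l : V4) : l - e1 ≤ l ∧ l - e2 ≤ l ∧ l - e3 ≤ l ∧ l - e4 ≤ l := by
  simp [le_iff]

lemma T_ideal (ha : 0 < a) (hb : 0 < b) (hc : 0 < c) (hd : 0 < d)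
    (hab : a + b = N) (hcd : c + d = N) (t : ℤ) (I K : Finset V4)
    (hI : I ⊆ slab a b c d (t - N + 1) (t - 1)) (hK : K ⊆ slab a b c d t t) :
    I ∪ K ∈ Ideals (slab a b c d (t - N + 1) (t - 1) ∪ slab a b c d t t) ↔
      I ∈ Ideals (slab a b c d (t - N + 1) (t - 1)) ∧
        Tin a b c d t I ⊆ K ∧ K ⊆ TU a b c d t I := by
  have mI : ∀ l ∈ I, t - N + 1 ≤ linS a b c d l ∧ linS a b c d l ≤ t - 1 ∧ Orth l :=
    fun l hl => (mem_slab ha hb hc hd l).1 (hI hl)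
  have mK : ∀ l ∈ K, t ≤ linS a b c d l ∧ linS a b c d l ≤ t ∧ Orth l :=
    fun l hl => (mem_slab ha hb hc hd l).1 (hK hl)
  simp only [mem_Ideals, mem_union]
  constructor
  · rintro ⟨-, h⟩
    refine ⟨⟨hI, ?_⟩, ?_, ?_⟩
    · intro m hm l hl hlm
      rcases h m (Or.inl hm) l (Or.inl hl) hlm with h' | h'
      · exact h'
      · have := mK l h'
        rw [mem_slab ha hb hc hd] at hl
        omega
    · intro l hl
      simp only [Tin, mem_filter] at hl
      have h2 : l ∈ I ∨ l ∈ K := by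
        rcases hl.2 with h' | h'
        · exact h _ (Or.inl h') l (Or.inr hl.1) (le_add_e l).2.2.1
        · exact h _ (Or.inl h') l (Or.inr hl.1) (le_add_e l).2.2.2
      rcases h2 with h2 | h2
      · have := mI l h2
        have := (mem_slab ha hb hc hd l).1 hl.1
        omega
      · exact h2
    · intro l hl
      have hl' := mK l hl
      simp only [TU, mem_filter]
      refine ⟨hK hl, fun hp => ?_, fun hp => ?_⟩
      · have hm : l - e1 ∈ slab a b c d (t - N + 1) (t - 1) := by
          rw [mem_slab ha hb hc hd, linS_sub]
          simp only [Orth, Pi.sub_apply, linS_e1, e1_0, e1_1, e1_2, e1_3] at hl' ⊢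
          omega
        rcases h l (Or.inr hl) _ (Or.inl hm) (sub_e_le l).1 with h' | h'
        · exact h'
        · have := mK _ h'
          rw [mem_slab ha hb hc hd] at hm
          omega
      · have hm : l - e2 ∈ slab a b c d (t - N + 1) (t - 1) := by
          rw [mem_slab ha hb hc hd, linS_sub]
          simp only [Orth, Pi.sub_apply, linS_e2, e2_0, e2_1, e2_2, e2_3] at hl' ⊢
          omega
        rcases h l (Or.inr hl) _ (Or.inl hm) (sub_e_le l).2.1 with h' | h'
        · exact h'
        · have := mK _ h'
          rw [mem_slab ha hb hc hd] at hm
          omega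
  · rintro ⟨⟨-, hi⟩, hA, hU⟩
    refine ⟨union_subset_union hI hK, ?_⟩
    -- membership of upper neighbours
    have up3 : ∀ l ∈ slab a b c d t t, ∀ m ∈ I, l + e3 ≤ m → l ∈ K := by
      intro l hl m hm hle
      apply hA
      simp only [Tin, mem_filter]
      refine ⟨hl, Or.inl (hi m hm _ ?_ hle)⟩
      have := mI m hm
      rw [mem_slab ha hb hc hd] at hl ⊢
      rw [linS_add, linS_e3]
      rw [le_iff] at hle
      simp only [Orth, Pi.add_apply, e3_0, e3_1, e3_2, e3_3] at *
      omega
    have up4 : ∀ l ∈ slab a b c d t t, ∀ m ∈ I, l + e4 ≤ m → l ∈ K := by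
      intro l hl m hm hle
      apply hA
      simp only [Tin, mem_filter]
      refine ⟨hl, Or.inr (hi m hm _ ?_ hle)⟩
      have := mI m hm
      rw [mem_slab ha hb hc hd] at hl ⊢
      rw [linS_add, linS_e4]
      rw [le_iff] at hle
      simp only [Orth, Pi.add_apply, e4_0, e4_1, e4_2, e4_3] at *
      omega
    -- for `m ∈ K` and something strictly below
    have dn : ∀ m ∈ K, ∀ l, Orth l → l ≤ m → l ≠ m → linS a b c d l ≤ linS a b c d m →
        ∃ m' ∈ I, (∀ i : Fin 4, 2 ≤ i → m' i = m i) ∧ l ≤ m' := by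
      intro m hm l hlo hlm hne hf
      have hmU := hU hm
      simp only [TU, mem_filter] at hmU
      rcases dir_pos hc hd hlm hf hne with h' | h'
      · refine ⟨m - e1, hmU.2.1 ?_, ?_, ?_⟩
        · rw [le_iff] at h'
          simp only [Orth, Pi.add_apply, e1_0, e1_1, e1_2, e1_3] at *
          omega
        · intro i hi
          fin_cases i <;> simp at hi ⊢
        · exact le_sub_iff_add_le.2 h'
      · refine ⟨m - e2, hmU.2.2 ?_, ?_, ?_⟩
        · rw [le_iff] at h'
          simp only [Orth, Pi.add_apply, e2_0, e2_1, e2_2, e2_3] at *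
          omega
        · intro i hi
          fin_cases i <;> simp at hi ⊢
        · exact le_sub_iff_add_le.2 h'
    rintro m (hm | hm) l (hl | hl) hlm
    · exact Or.inl (hi m hm l hl hlm)
    · right
      have h1 := mI m hm
      have h2 := (mem_slab ha hb hc hd l).1 hl
      have hne : l ≠ m := by rintro rfl; omega
      rcases dir_neg ha hb hlm (c := c) (d := d) (by omega) hne with h' | h'
      · exact up3 l hl m hm h'
      · exact up4 l hl m hm h'
    · left
      have h1 := mK m hm
      have h2 := (mem_slab ha hb hc hd l).1 hl
      have hne : l ≠ m := by rintro rfl; omega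
      obtain ⟨m', hm', -, hle⟩ := dn m hm l h2.2.2 hlm hne (by omega)
      exact hi m' hm' l hl hle
    · right
      by_cases hne : l = m
      · exact hne ▸ hm
      have h1 := mK m hm
      have h2 := (mem_slab ha hb hc hd l).1 hl
      obtain ⟨m', hm', heq, hle⟩ := dn m hm l h2.2.2 hlm hne (by omega)
      have q2 := heq 2 (by decide)
      have q3 := heq 3 (by decide)
      rcases dir_neg ha hb hlm (c := c) (d := d) (by omega) hne with h' | h'
      · refine up3 l hl m' hm' ?_
        rw [le_iff] at *
        simp only [Pi.add_apply, e3_0, e3_1, e3_2, e3_3] at *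
        omega
      · refine up4 l hl m' hm' ?_
        rw [le_iff] at *
        simp only [Pi.add_apply, e4_0, e4_1, e4_2, e4_3] at *
        omega

lemma B_ideal (ha : 0 < a) (hb : 0 < b) (hc : 0 < c) (hd : 0 < d)
    (hab : a + b = N) (hcd : c + d = N) (t : ℤ) (I K : Finset V4)
    (hI : I ⊆ slab a b c d (t - N + 1) (t - 1)) (hK : K ⊆ slab a b c d (t - N) (t - N)) :
    I ∪ K ∈ Ideals (slab a b c d (t - N + 1) (t - 1) ∪ slab a b c d (t - N) (t - N)) ↔
      I ∈ Ideals (slab a b c d (t - N + 1) (t - 1)) ∧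
        Bin a b c d (t - N) I ⊆ K ∧ K ⊆ BU a b c d (t - N) I := by
  have mI : ∀ l ∈ I, t - N + 1 ≤ linS a b c d l ∧ linS a b c d l ≤ t - 1 ∧ Orth l :=
    fun l hl => (mem_slab ha hb hc hd l).1 (hI hl)
  have mK : ∀ l ∈ K, t - N ≤ linS a b c d l ∧ linS a b c d l ≤ t - N ∧ Orth l :=
    fun l hl => (mem_slab ha hb hc hd l).1 (hK hl)
  simp only [mem_Ideals, mem_union]
  constructor
  · rintro ⟨-, h⟩
    refine ⟨⟨hI, ?_⟩, ?_, ?_⟩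
    · intro m hm l hl hlm
      rcases h m (Or.inl hm) l (Or.inl hl) hlm with h' | h'
      · exact h'
      · have := mK l h'
        rw [mem_slab ha hb hc hd] at hl
        omega
    · intro l hl
      simp only [Bin, mem_filter] at hl
      have h2 : l ∈ I ∨ l ∈ K := by
        rcases hl.2 with h' | h'
        · exact h _ (Or.inl h') l (Or.inr hl.1) (le_add_e l).1
        · exact h _ (Or.inl h') l (Or.inr hl.1) (le_add_e l).2.1
      rcases h2 with h2 | h2
      · have := mI l h2
        have := (mem_slab ha hb hc hd l).1 hl.1
        omega
      · exact h2
    · intro l hl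
      have hl' := mK l hl
      simp only [BU, mem_filter]
      refine ⟨hK hl, ?_, ?_⟩
      · have hm : l - e3 ∈ slab a b c d (t - N + 1) (t - 1) := by
          rw [mem_slab ha hb hc hd, linS_sub]
          simp only [Orth, Pi.sub_apply, linS_e3, e3_0, e3_1, e3_2, e3_3] at hl' ⊢
          omega
        rcases h l (Or.inr hl) _ (Or.inl hm) (sub_e_le l).2.2.1 with h' | h'
        · exact h'
        · have := mK _ h'
          rw [mem_slab ha hb hc hd] at hm
          omega
      · have hm : l - e4 ∈ slab a b c d (t - N + 1) (t - 1) := by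
          rw [mem_slab ha hb hc hd, linS_sub]
          simp only [Orth, Pi.sub_apply, linS_e4, e4_0, e4_1, e4_2, e4_3] at hl' ⊢
          omega
        rcases h l (Or.inr hl) _ (Or.inl hm) (sub_e_le l).2.2.2 with h' | h'
        · exact h'
        · have := mK _ h'
          rw [mem_slab ha hb hc hd] at hm
          omega
  · rintro ⟨⟨-, hi⟩, hA, hU⟩
    refine ⟨union_subset_union hI hK, ?_⟩
    have up1 : ∀ l ∈ slab a b c d (t - N) (t - N), ∀ m ∈ I, l + e1 ≤ m → l ∈ K := by
      intro l hl m hm hle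
      apply hA
      simp only [Bin, mem_filter]
      refine ⟨hl, Or.inl (hi m hm _ ?_ hle)⟩
      rw [mem_slab ha hb hc hd] at hl ⊢
      rw [linS_add, linS_e1]
      simp only [Orth, Pi.add_apply, e1_0, e1_1, e1_2, e1_3] at *
      omega
    have up2 : ∀ l ∈ slab a b c d (t - N) (t - N), ∀ m ∈ I, l + e2 ≤ m → l ∈ K := by
      intro l hl m hm hle
      apply hA
      simp only [Bin, mem_filter]
      refine ⟨hl, Or.inr (hi m hm _ ?_ hle)⟩
      rw [mem_slab ha hb hc hd] at hl ⊢
      rw [linS_add, linS_e2]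
      simp only [Orth, Pi.add_apply, e2_0, e2_1, e2_2, e2_3] at *
      omega
    have dn : ∀ m ∈ K, ∀ l, l ≤ m → l ≠ m → linS a b c d m ≤ linS a b c d l →
        ∃ m' ∈ I, (∀ i : Fin 4, i < 2 → m' i = m i) ∧ l ≤ m' := by
      intro m hm l hlm hne hf
      have hmU := hU hm
      simp only [BU, mem_filter] at hmU
      rcases dir_neg ha hb hlm hf hne with h' | h'
      · refine ⟨m - e3, hmU.2.1, ?_, ?_⟩
        · intro i hi
          fin_cases i <;> simp at hi ⊢
        · exact le_sub_iff_add_le.2 h'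
      · refine ⟨m - e4, hmU.2.2, ?_, ?_⟩
        · intro i hi
          fin_cases i <;> simp at hi ⊢
        · exact le_sub_iff_add_le.2 h'
    rintro m (hm | hm) l (hl | hl) hlm
    · exact Or.inl (hi m hm l hl hlm)
    · right
      have h1 := mI m hm
      have h2 := (mem_slab ha hb hc hd l).1 hl
      have hne : l ≠ m := by rintro rfl; omega
      rcases dir_pos hc hd hlm (a := a) (b := b) (by omega) hne with h' | h'
      · exact up1 l hl m hm h'
      · exact up2 l hl m hm h'
    · left
      have h1 := mK m hm
      have h2 := (mem_slab ha hb hc hd l).1 hl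
      have hne : l ≠ m := by rintro rfl; omega
      obtain ⟨m', hm', -, hle⟩ := dn m hm l hlm hne (by omega)
      exact hi m' hm' l hl hle
    · right
      by_cases hne : l = m
      · exact hne ▸ hm
      have h1 := mK m hm
      have h2 := (mem_slab ha hb hc hd l).1 hl
      obtain ⟨m', hm', heq, hle⟩ := dn m hm l hlm hne (by omega)
      have q2 := heq 0 (by decide)
      have q3 := heq 1 (by decide)
      rcases dir_pos hc hd hlm (a := a) (b := b) (by omega) hne with h' | h'
      · refine up1 l hl m' hm' ?_
        rw [le_iff] at *
        simp only [Pi.add_apply, e1_0, e1_1, e1_2, e1_3] at *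
        omega
      · refine up2 l hl m' hm' ?_
        rw [le_iff] at *
        simp only [Pi.add_apply, e2_0, e2_1, e2_2, e2_3] at *
        omega

lemma T_sub (ha : 0 < a) (hb : 0 < b) (hc : 0 < c) (hd : 0 < d)
    (hab : a + b = N) (hcd : c + d = N) (t : ℤ) (I : Finset V4)
    (hI : I ∈ Ideals (slab a b c d (t - N + 1) (t - 1))) :
    Tin a b c d t I ⊆ TU a b c d t I := by
  obtain ⟨hI, hi⟩ := mem_Ideals.1 hI
  intro l hl
  simp only [Tin, TU, mem_filter] at hl ⊢
  obtain ⟨h1, h2⟩ := hl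
  have h1' := (mem_slab ha hb hc hd l).1 h1
  have key : ∀ e : V4, (e = e1 ∨ e = e2) → Orth (l - e) → l - e ∈ I := by
    intro e he ho
    have hm : l - e ∈ slab a b c d (t - N + 1) (t - 1) := by
      rw [mem_slab ha hb hc hd, linS_sub]
      refine ⟨?_, ?_, ho⟩ <;> rcases he with rfl | rfl <;> simp only [linS_e1, linS_e2] <;> omega
    have hle : l - e ≤ l := by
      rcases he with rfl | rfl
      · exact (sub_e_le l).1
      · exact (sub_e_le l).2.1
    rcases h2 with h2 | h2
    · exact hi _ h2 _ hm (hle.trans (le_add_e l).2.2.1)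
    · exact hi _ h2 _ hm (hle.trans (le_add_e l).2.2.2)
  refine ⟨h1, fun hp => key e1 (Or.inl rfl) ?_, fun hp => key e2 (Or.inr rfl) ?_⟩
  all_goals
    simp only [Orth, Pi.sub_apply, e1_0, e1_1, e1_2, e1_3, e2_0, e2_1, e2_2, e2_3] at *
    omega

lemma B_sub (ha : 0 < a) (hb : 0 < b) (hc : 0 < c) (hd : 0 < d)
    (hab : a + b = N) (hcd : c + d = N) (t : ℤ) (I : Finset V4)
    (hI : I ∈ Ideals (slab a b c d (t - N + 1) (t - 1))) :
    Bin a b c d (t - N) I ⊆ BU a b c d (t - N) I := by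
  obtain ⟨hI, hi⟩ := mem_Ideals.1 hI
  intro l hl
  simp only [Bin, BU, mem_filter] at hl ⊢
  obtain ⟨h1, h2⟩ := hl
  have h1' := (mem_slab ha hb hc hd l).1 h1
  have key : ∀ e : V4, (e = e3 ∨ e = e4) → Orth (l - e) → l - e ∈ I := by
    intro e he ho
    have hm : l - e ∈ slab a b c d (t - N + 1) (t - 1) := by
      rw [mem_slab ha hb hc hd, linS_sub]
      refine ⟨?_, ?_, ho⟩ <;> rcases he with rfl | rfl <;> simp only [linS_e3, linS_e4] <;> omega
    have hle : l - e ≤ l := by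
      rcases he with rfl | rfl
      · exact (sub_e_le l).2.2.1
      · exact (sub_e_le l).2.2.2
    rcases h2 with h2 | h2
    · exact hi _ h2 _ hm (hle.trans (le_add_e l).1)
    · exact hi _ h2 _ hm (hle.trans (le_add_e l).2.1)
  refine ⟨h1, key e3 (Or.inl rfl) ?_, key e4 (Or.inr rfl) ?_⟩
  all_goals
    simp only [Orth, Pi.sub_apply, e3_0, e3_1, e3_2, e3_3, e4_0, e4_1, e4_2, e4_3] at *
    omega

/-- counting by a shift -/
lemma card_shift (S T : Finset V4) (p q : V4 → Prop) [DecidablePred p] [DecidablePred q] (v : V4)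
    (h : ∀ l, (l ∈ S ∧ p l) ↔ (l + v ∈ T ∧ q (l + v))) :
    (S.filter p).card = (T.filter q).card := by
  refine Finset.card_bij' (fun l _ => l + v) (fun l _ => l - v) ?_ ?_ ?_ ?_
  · intro l hl; rw [mem_filter] at *; exact (h l).1 hl
  · intro l hl; rw [mem_filter] at *; apply (h _).2; simpa using hl
  · simp
  · simp

lemma card_U (ha : 0 < a) (hb : 0 < b) (hc : 0 < c) (hd : 0 < d)
    (hab : a + b = N) (hcd : c + d = N) (t : ℤ) (I : Finset V4)
    (hI : I ⊆ slab a b c d (t - N + 1) (t - 1)) :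
    (TU a b c d t I).card + (Bin a b c d (t - N) I).card =
      (I.filter (fun l => linS a b c d l = t - a)).card +
      (I.filter (fun l => linS a b c d l = t - b)).card +
      ((slab a b c d t t).filter (fun l => l 0 = 0 ∧ l 1 = 0)).card := by
  have mI : ∀ l ∈ I, t - N + 1 ≤ linS a b c d l ∧ linS a b c d l ≤ t - 1 ∧ Orth l :=
    fun l hl => (mem_slab ha hb hc hd l).1 (hI hl)
  have c1 : (I.filter (fun l => linS a b c d l = t - a)).card
      = ((slab a b c d t t).filter (fun l => l - e1 ∈ I)).card := by
    apply card_shift _ _ _ _ e1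
    intro l
    have := mI l
    simp only [mem_slab ha hb hc hd, linS_add, linS_e1, add_sub_cancel_right, Orth, Pi.add_apply,
      e1_0, e1_1, e1_2, e1_3] at *
    constructor
    · rintro ⟨h1, h2⟩; have := this h1; exact ⟨by omega, h1⟩
    · rintro ⟨h1, h2⟩; exact ⟨h2, by omega⟩
  have c2 : (I.filter (fun l => linS a b c d l = t - b)).card
      = ((slab a b c d t t).filter (fun l => l - e2 ∈ I)).card := by
    apply card_shift _ _ _ _ e2
    intro l
    have := mI l
    simp only [mem_slab ha hb hc hd, linS_add, linS_e2, add_sub_cancel_right, Orth, Pi.add_apply,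
      e2_0, e2_1, e2_2, e2_3] at *
    constructor
    · rintro ⟨h1, h2⟩; have := this h1; exact ⟨by omega, h1⟩
    · rintro ⟨h1, h2⟩; exact ⟨h2, by omega⟩
  have c3 : (Bin a b c d (t - N) I).card = ((slab a b c d t t).filter
      (fun l => (1 ≤ l 0 ∧ 1 ≤ l 1) ∧ (l - e1 ∈ I ∨ l - e2 ∈ I))).card := by
    apply card_shift _ _ _ _ (e1 + e2)
    intro l
    have r1 : l + (e1 + e2) - e1 = l + e2 := by abel
    have r2 : l + (e1 + e2) - e2 = l + e1 := by abel
    simp only [mem_slab ha hb hc hd, linS_add, linS_e2, linS_e1, r1, r2, Orth, Pi.add_apply,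
      e2_0, e2_1, e2_2, e2_3, e1_0, e1_1, e1_2, e1_3]
    constructor
    · rintro ⟨h1, h2⟩; exact ⟨by omega, by omega, h2.symm⟩
    · rintro ⟨h1, h2, h3⟩; exact ⟨by omega, h3.symm⟩
  rw [c1, c2, c3, TU]
  simp only [card_filter]
  rw [← sum_add_distrib, ← sum_add_distrib, ← sum_add_distrib]
  refine Finset.sum_congr rfl fun l hl => ?_
  rw [mem_slab ha hb hc hd] at hl
  have m1 := mI (l - e1)
  have m2 := mI (l - e2)
  simp only [Orth, Pi.sub_apply, e2_0, e2_1, e2_2, e2_3, e1_0, e1_1, e1_2, e1_3] at *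
  by_cases p1 : l - e1 ∈ I <;> by_cases p2 : l - e2 ∈ I <;> 
    simp only [p1, p2, implies_true, true_implies, false_implies, imp_false, true_and, and_true, false_and, and_false,
      or_true, true_or, or_false, false_or, and_self, or_self, if_true, if_false] at * <;>
    split_ifs <;> omega

lemma card_V (ha : 0 < a) (hb : 0 < b) (hc : 0 < c) (hd : 0 < d)
    (hab : a + b = N) (hcd : c + d = N) (t : ℤ) (I : Finset V4)
    (hI : I ⊆ slab a b c d (t - N + 1) (t - 1)) :
    (Tin a b c d t I).card + (BU a b c d (t - N) I).card =
      (I.filter (fun l => linS a b c d l = t - c)).card +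
      (I.filter (fun l => linS a b c d l = t - d)).card := by
  have mI : ∀ l ∈ I, t - N + 1 ≤ linS a b c d l ∧ linS a b c d l ≤ t - 1 ∧ Orth l :=
    fun l hl => (mem_slab ha hb hc hd l).1 (hI hl)
  have c1 : (I.filter (fun l => linS a b c d l = t - c)).card
      = ((slab a b c d t t).filter (fun l => l + e3 ∈ I)).card := by
    apply card_shift _ _ _ _ (-e3)
    intro l
    have := mI l
    simp only [← sub_eq_add_neg, mem_slab ha hb hc hd, linS_sub, linS_e3, sub_add_cancel, Orth, Pi.sub_apply,
      e3_0, e3_1, e3_2, e3_3] at *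
    constructor
    · rintro ⟨h1, h2⟩; have := this h1; exact ⟨by omega, h1⟩
    · rintro ⟨h1, h2⟩; exact ⟨h2, by omega⟩
  have c2 : (I.filter (fun l => linS a b c d l = t - d)).card
      = ((slab a b c d t t).filter (fun l => l + e4 ∈ I)).card := by
    apply card_shift _ _ _ _ (-e4)
    intro l
    have := mI l
    simp only [← sub_eq_add_neg, mem_slab ha hb hc hd, linS_sub, linS_e4, sub_add_cancel, Orth, Pi.sub_apply,
      e4_0, e4_1, e4_2, e4_3] at *
    constructor
    · rintro ⟨h1, h2⟩; have := this h1; exact ⟨by omega, h1⟩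
    · rintro ⟨h1, h2⟩; exact ⟨h2, by omega⟩
  have c3 : (BU a b c d (t - N) I).card = ((slab a b c d t t).filter
      (fun l => (l 2 ≤ -1 ∧ l 3 ≤ -1) ∧ (l + e3 ∈ I ∧ l + e4 ∈ I))).card := by
    apply card_shift _ _ _ _ (-(e3 + e4))
    intro l
    have r1 : l - (e3 + e4) + e3 = l - e4 := by abel
    have r2 : l - (e3 + e4) + e4 = l - e3 := by abel
    simp only [← sub_eq_add_neg, mem_slab ha hb hc hd, linS_sub, linS_add, linS_e3, linS_e4, r1, r2, Orth,
      Pi.sub_apply, Pi.neg_apply, Pi.add_apply, e3_0, e3_1, e3_2, e3_3, e4_0, e4_1, e4_2, e4_3]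
    constructor
    · rintro ⟨h1, h2⟩; exact ⟨by omega, by omega, h2.symm⟩
    · rintro ⟨h1, h2, h3⟩; exact ⟨by omega, h3.symm⟩
  rw [c1, c2, c3, Tin]
  simp only [card_filter]
  rw [← sum_add_distrib, ← sum_add_distrib]
  refine Finset.sum_congr rfl fun l hl => ?_
  rw [mem_slab ha hb hc hd] at hl
  have m1 := mI (l + e3)
  have m2 := mI (l + e4)
  simp only [Orth, Pi.add_apply, e3_0, e3_1, e3_2, e3_3, e4_0, e4_1, e4_2, e4_3] at *
  by_cases p1 : l + e3 ∈ I <;> by_cases p2 : l + e4 ∈ I <;> 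
    simp only [p1, p2, implies_true, true_implies, false_implies, imp_false, true_and, and_true, false_and, and_false,
      or_true, true_or, or_false, false_or, and_self, or_self, if_true, if_false] at * <;>
    split_ifs <;> omega

end
end GR

namespace GR
open Finset
set_option linter.all false

def sP (x : ℤ → ℚ) (a b k : ℤ) : ℚ := x (k + a) * x (k + b)
def sR (x : ℤ → ℚ) (N k : ℤ) : ℚ := x k * x (k + N)

def yv (x : ℤ → ℚ) (a b c d N w l : ℤ) : ℚ :=
  sP x c d (l - N) / sP x a b (l - N)
    * (if l - a ≤ w then sR x N (l - a) / sP x c d (l - a) else 1)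
    * (if l - b ≤ w then sR x N (l - b) / sP x c d (l - b) else 1)
    * (if l - c ≤ w then sP x a b (l - c) / sR x N (l - c) else 1)
    * (if l - d ≤ w then sP x a b (l - d) / sR x N (l - d) else 1)

section
variable {a b c d N : ℤ} {x : ℤ → ℚ}

lemma y_top (ha : 0 < a) (hb : 0 < b) (hc : 0 < c) (hd : 0 < d)
    (hab : a + b = N) (hcd : c + d = N) (hnz : ∀ i, x i ≠ 0) (w : ℤ) :
    yv x a b c d N w (w + 1) = sP x a b (w + 1) / sP x c d (w + 1) := by
  unfold yv
  rw [if_pos (by omega), if_pos (by omega), if_pos (by omega), if_pos (by omega)]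
  unfold sP sR
  generalize w + 1 = l
  have hdd : d = a + b - c := by omega
  subst hdd
  subst hab
  rw [show l - (a + b) + c = l - (a + b - c) by ring,
    show l - (a + b) + (a + b - c) = l - c by ring,
    show l - (a + b) + a = l - b by ring, show l - (a + b) + b = l - a by ring,
    show l - a + (a + b) = l + b by ring, show l - b + (a + b) = l + a by ring,
    show l - c + (a + b) = l + (a + b - c) by ring,
    show l - (a + b - c) + (a + b) = l + c by ring,
    show l - a + (a + b - c) = l + b - c by ring,
    show l - b + (a + b - c) = l + a - c by ring,
    show l - c + a = l + a - c by ring, show l - c + b = l + b - c by ring,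
    show l - (a + b - c) + a = l - b + c by ring,
    show l - (a + b - c) + b = l - a + c by ring]
  have h1 := hnz (l - (a + b - c))
  have h2 := hnz (l - c)
  have h3 := hnz (l - b)
  have h4 := hnz (l - a)
  have h5 := hnz (l + b)
  have h6 := hnz (l + a)
  have h7 := hnz (l + (a + b - c))
  have h8 := hnz (l + c)
  have h9 := hnz (l + b - c)
  have h10 := hnz (l + a - c)
  have h11 := hnz (l - b + c)
  have h12 := hnz (l - a + c)
  generalize x (l - (a + b - c)) = z1 at *
  generalize x (l - c) = z2 at *
  generalize x (l - b) = z3 at *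
  generalize x (l - a) = z4 at *
  generalize x (l + b) = z5 at *
  generalize x (l + a) = z6 at *
  generalize x (l + (a + b - c)) = z7 at *
  generalize x (l + c) = z8 at *
  generalize x (l + b - c) = z9 at *
  generalize x (l + a - c) = z10 at *
  generalize x (l - b + c) = z11 at *
  generalize x (l - a + c) = z12 at *
  field_simp

lemma y_new (ha : 0 < a) (hb : 0 < b) (hc : 0 < c) (hd : 0 < d)
    (hab : a + b = N) (hcd : c + d = N) (w : ℤ) :
    yv x a b c d N w (w + N) = sP x c d w / sP x a b w := by
  unfold yv
  rw [if_neg (by omega), if_neg (by omega), if_neg (by omega), if_neg (by omega)]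
  simp

lemma ite_step (w l s : ℤ) (F : ℤ → ℚ) :
    (if l - s ≤ w + 1 then F (l - s) else 1) = (if l - s ≤ w then F (l - s) else 1) *
      (if l = w + 1 + s then F (w + 1) else 1) := by
  by_cases h : l = w + 1 + s
  · rw [if_pos (by omega), if_neg (by omega), if_pos h, one_mul]
    congr 1; omega
  · rw [if_neg h, mul_one]
    by_cases h' : l - s ≤ w
    · rw [if_pos h', if_pos (by omega)]
    · rw [if_neg h', if_neg (by omega)]

lemma y_step (w l : ℤ) :
    yv x a b c d N (w + 1) l = yv x a b c d N w l
      * (if l = w + 1 + a then sR x N (w + 1) / sP x c d (w + 1) else 1)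
      * (if l = w + 1 + b then sR x N (w + 1) / sP x c d (w + 1) else 1)
      * (if l = w + 1 + c then sP x a b (w + 1) / sR x N (w + 1) else 1)
      * (if l = w + 1 + d then sP x a b (w + 1) / sR x N (w + 1) else 1) := by
  unfold yv
  rw [ite_step w l a (fun k => sR x N k / sP x c d k), ite_step w l b (fun k => sR x N k / sP x c d k),
    ite_step w l c (fun k => sP x a b k / sR x N k), ite_step w l d (fun k => sP x a b k / sR x N k)]
  ring

lemma y_zero (ha : 0 < a) (hb : 0 < b) (hc : 0 < c) (hd : 0 < d)
    (hab : a + b = N) (hcd : c + d = N) (h1 : ∀ k ≤ N, x k = 1) (l : ℤ) (hl : l ≤ N) :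
    yv x a b c d N 0 l = 1 := by
  have hP : ∀ k ≤ 0, sP x a b k = 1 := by
    intro k hk; unfold sP; rw [h1 _ (by omega), h1 _ (by omega), one_mul]
  have hQ : ∀ k ≤ 0, sP x c d k = 1 := by
    intro k hk; unfold sP; rw [h1 _ (by omega), h1 _ (by omega), one_mul]
  have hR : ∀ k ≤ 0, sR x N k = 1 := by
    intro k hk; unfold sR; rw [h1 _ (by omega), h1 _ (by omega), one_mul]
  have t1 : ∀ k : ℤ, (if k ≤ 0 then sR x N k / sP x c d k else 1) = 1 := by
    intro k; split_ifs with h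
    · rw [hR k h, hQ k h, div_one]
    · rfl
  have t2 : ∀ k : ℤ, (if k ≤ 0 then sP x a b k / sR x N k else 1) = 1 := by
    intro k; split_ifs with h
    · rw [hR k h, hP k h, div_one]
    · rfl
  unfold yv
  rw [t1, t1, t2, t2, hP _ (by omega), hQ _ (by omega)]
  norm_num

noncomputable def GG (x : ℤ → ℚ) (a b c d N n w : ℤ) : ℚ :=
  ∑ I ∈ Ideals (slab a b c d (n - w - N) (n - w - 1)), ∏ l ∈ I, yv x a b c d N w (n - linS a b c d l)

noncomputable def kap (a b c d t : ℤ) : ℕ :=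
  ((slab a b c d t t).filter (fun l => l 0 = 0 ∧ l 1 = 0)).card

lemma pow_id (p q r : ℚ) (hp : p ≠ 0) (hq : q ≠ 0) (hr : r ≠ 0) (Ti al Bi be na nb nc nd k : ℕ)
    (h1 : Ti + al + Bi = na + nb + k) (h2 : Ti + (Bi + be) = nc + nd) :
    (p / q) ^ Ti * (r / q) ^ al = (r / q) ^ k *
      (((r / q) ^ na * (r / q) ^ nb * (p / r) ^ nc * (p / r) ^ nd) * ((q / p) ^ Bi * (r / p) ^ be)) := by
  have e : (r / q) ^ k *
      (((r / q) ^ na * (r / q) ^ nb * (p / r) ^ nc * (p / r) ^ nd) * ((q / p) ^ Bi * (r / p) ^ be))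
      = (r / q) ^ (na + nb + k) * (p / r) ^ (nc + nd) * ((q / p) ^ Bi * (r / p) ^ be) := by
    rw [pow_add, pow_add, pow_add]; ring
  rw [e, ← h1, ← h2]
  have e2 : (r / q) ^ (Ti + al + Bi) * (p / r) ^ (Ti + (Bi + be)) * ((q / p) ^ Bi * (r / p) ^ be)
      = ((r / q) * (p / r)) ^ Ti * (r / q) ^ al * ((r / q) * (p / r) * (q / p)) ^ Bi
        * ((p / r) * (r / p)) ^ be := by
    simp only [pow_add, mul_pow]; ring
  rw [e2, show (r / q) * (p / r) = p / q by field_simp, show (p / q) * (q / p) = 1 by field_simp,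
    show (p / r) * (r / p) = 1 by field_simp]
  simp

lemma G_step (ha : 0 < a) (hb : 0 < b) (hc : 0 < c) (hd : 0 < d)
    (hab : a + b = N) (hcd : c + d = N) (hnz : ∀ i, x i ≠ 0)
    (hrec : ∀ k, 1 ≤ k → sR x N k = sP x a b k + sP x c d k) (n w : ℤ) (hw : 0 ≤ w) :
    GG x a b c d N n w = (sR x N (w + 1) / sP x c d (w + 1)) ^ kap a b c d (n - (w + 1))
      * GG x a b c d N n (w + 1) := by
  have hp : sP x a b (w + 1) ≠ 0 := mul_ne_zero (hnz _) (hnz _)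
  have hq : sP x c d (w + 1) ≠ 0 := mul_ne_zero (hnz _) (hnz _)
  have hr : sR x N (w + 1) ≠ 0 := mul_ne_zero (hnz _) (hnz _)
  have hR := hrec (w + 1) (by omega)
  obtain ⟨t, ht⟩ : ∃ t, t = n - (w + 1) := ⟨_, rfl⟩
  have s1 : slab a b c d (n - w - N) (n - w - 1)
      = slab a b c d (t - N + 1) (t - 1) ∪ slab a b c d t t := by
    ext l; simp only [mem_union, mem_slab ha hb hc hd, Orth]; omega
  have s2 : slab a b c d (n - (w + 1) - N) (n - (w + 1) - 1)
      = slab a b c d (t - N + 1) (t - 1) ∪ slab a b c d (t - N) (t - N) := by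
    ext l; simp only [mem_union, mem_slab ha hb hc hd, Orth]; omega
  have d1 : Disjoint (slab a b c d (t - N + 1) (t - 1)) (slab a b c d t t) := by
    rw [Finset.disjoint_left]; intro l h h'; rw [mem_slab ha hb hc hd] at h h'; omega
  have d2 : Disjoint (slab a b c d (t - N + 1) (t - 1)) (slab a b c d (t - N) (t - N)) := by
    rw [Finset.disjoint_left]; intro l h h'; rw [mem_slab ha hb hc hd] at h h'; omega
  unfold GG
  rw [s1, s2, ext_sum _ _ d1 (Tin a b c d t) (TU a b c d t) (T_sub ha hb hc hd hab hcd t)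
      (fun I => filter_subset _ _) (T_ideal ha hb hc hd hab hcd t) _
      (sP x a b (w + 1) / sP x c d (w + 1)) ?_,
    ext_sum _ _ d2 (Bin a b c d (t - N)) (BU a b c d (t - N)) (B_sub ha hb hc hd hab hcd t)
      (fun I => filter_subset _ _) (B_ideal ha hb hc hd hab hcd t) _
      (sP x c d (w + 1) / sP x a b (w + 1)) ?_, Finset.mul_sum, ← ht]
  rotate_left
  · intro l hl
    rw [mem_slab ha hb hc hd] at hl
    rw [show n - linS a b c d l = w + 1 + N by omega, y_new ha hb hc hd hab hcd]
  · intro l hl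
    rw [mem_slab ha hb hc hd] at hl
    rw [show n - linS a b c d l = w + 1 by omega, y_top ha hb hc hd hab hcd hnz]
  refine Finset.sum_congr rfl fun I hI => ?_
  have hIM := (mem_Ideals.1 hI).1
  have cU := card_U ha hb hc hd hab hcd t I hIM
  have cV := card_V ha hb hc hd hab hcd t I hIM
  have lT := card_le_card (T_sub ha hb hc hd hab hcd t I hI)
  have lB := card_le_card (B_sub ha hb hc hd hab hcd t I hI)
  obtain ⟨al, hal⟩ := Nat.exists_eq_add_of_le lT
  obtain ⟨be, hbe⟩ := Nat.exists_eq_add_of_le lB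
  have f1 : 1 + sP x a b (w + 1) / sP x c d (w + 1) = sR x N (w + 1) / sP x c d (w + 1) := by
    rw [hR]; field_simp; ring
  have f2 : 1 + sP x c d (w + 1) / sP x a b (w + 1) = sR x N (w + 1) / sP x a b (w + 1) := by
    rw [hR]; field_simp
  have pr : ∀ (s : ℤ) (F : ℚ), ∏ l ∈ I, (if n - linS a b c d l = w + 1 + s then F else 1)
      = F ^ (I.filter (fun l => linS a b c d l = t - s)).card := by
    intro s F
    rw [Finset.prod_ite]
    simp only [prod_const, one_pow, mul_one]
    congr 2
    apply Finset.filter_congr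
    intro l _
    omega
  simp only [y_step, Finset.prod_mul_distrib, pr]
  rw [f1, f2, hal, hbe, Nat.add_sub_cancel_left, Nat.add_sub_cancel_left]
  rw [hal] at cU
  rw [hbe] at cV
  have := pow_id _ _ _ hp hq hr _ _ _ _ _ _ _ _ _ cU cV
  rw [this]
  unfold kap
  ring

end
end GR

namespace GR
open Finset
set_option linter.all false

section
variable {a b c d N : ℤ} {x : ℤ → ℚ}

lemma kap_eq (ha : 0 < a) (hb : 0 < b) (hc : 0 < c) (hd : 0 < d) (t : ℤ) (M : ℕ) (hM : t < M) :
    kap a b c d t = ((range M ×ˢ range M).filter (fun p => c * p.1 + d * p.2 = t)).card := by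
  unfold kap
  refine Finset.card_bij' (fun l _ => ((-l 2).toNat, (-l 3).toNat))
    (fun p _ => ![0, 0, -(p.1 : ℤ), -(p.2 : ℤ)]) ?_ ?_ ?_ ?_
  · intro l hl
    rw [mem_filter, mem_slab ha hb hc hd] at hl
    obtain ⟨⟨h1, h2, h3⟩, h4, h5⟩ := hl
    unfold Orth at h3
    unfold linS at h1 h2
    rw [h4, h5] at h1 h2
    have q2 : -l 2 ≤ -(c * l 2) := by nlinarith
    have q3 : -l 3 ≤ -(d * l 3) := by nlinarith
    have q2' : 0 ≤ -(c * l 2) := by nlinarith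
    have q3' : 0 ≤ -(d * l 3) := by nlinarith
    simp only [mem_filter, mem_product, mem_range]
    rw [Int.toNat_of_nonneg (by omega), Int.toNat_of_nonneg (by omega)]
    refine ⟨⟨by omega, by omega⟩, by linarith⟩
  · rintro ⟨r, s⟩ hp
    simp only [mem_filter, mem_product, mem_range] at hp
    rw [mem_filter, mem_slab ha hb hc hd]
    simp only [linS, Orth, Matrix.cons_val]
    refine ⟨⟨by linarith, by linarith, by omega⟩, by simp⟩
  · intro l hl
    rw [mem_filter, mem_slab ha hb hc hd] at hl
    obtain ⟨⟨h1, h2, h3⟩, h4, h5⟩ := hl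
    unfold Orth at h3
    funext i
    fin_cases i <;> simp <;> omega
  · rintro ⟨r, s⟩ hp
    simp

lemma G_prod (ha : 0 < a) (hb : 0 < b) (hc : 0 < c) (hd : 0 < d)
    (hab : a + b = N) (hcd : c + d = N) (hnz : ∀ i, x i ≠ 0)
    (hrec : ∀ k, 1 ≤ k → sR x N k = sP x a b k + sP x c d k) (n M : ℕ) (hM : n < M) (m : ℕ) :
    ∀ w : ℤ, 0 ≤ w → w + m = n → GG x a b c d N n w =
      ∏ p ∈ range M ×ˢ range M, (if c * p.1 + d * p.2 ≤ n - w - 1 then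
        sR x N (n - (c * p.1 + d * p.2)) / sP x c d (n - (c * p.1 + d * p.2)) else 1) := by
  induction m with
  | zero =>
    intro w hw hwm
    have hwn : w = n := by simpa using hwm
    subst hwn
    rw [Finset.prod_eq_one]
    · have : slab a b c d ((n:ℤ) - n - N) ((n:ℤ) - n - 1) = ∅ := by
        rw [Finset.eq_empty_iff_forall_notMem]
        intro l hl
        rw [mem_slab ha hb hc hd] at hl
        obtain ⟨h1, h2, h3, h4, h5, h6⟩ := hl
        unfold linS at h2
        nlinarith [mul_nonneg ha.le h3, mul_nonneg hb.le h4, mul_nonneg hc.le (neg_nonneg.2 h5),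
          mul_nonneg hd.le (neg_nonneg.2 h6)]
      unfold GG
      rw [this]
      have : Ideals ∅ = {∅} := by
        ext I; simp only [mem_Ideals, mem_singleton, subset_empty]
        constructor
        · exact fun h => h.1
        · rintro rfl; simp
      rw [this]; simp
    · intro p _
      rw [if_neg]
      have : 0 ≤ c * (p.1 : ℤ) := by positivity
      have : 0 ≤ d * (p.2 : ℤ) := by positivity
      omega
  | succ m ih =>
    intro w hw hwm
    push_cast at hwm
    rw [G_step ha hb hc hd hab hcd hnz hrec n w hw, ih (w + 1) (by omega) (by omega),
      kap_eq ha hb hc hd _ M (by omega)]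
    have : (sR x N (w + 1) / sP x c d (w + 1)) ^
        ((range M ×ˢ range M).filter (fun p => c * p.1 + d * p.2 = (n : ℤ) - (w + 1))).card
        = ∏ p ∈ range M ×ˢ range M, (if c * p.1 + d * p.2 = (n : ℤ) - (w + 1) then
            sR x N (w + 1) / sP x c d (w + 1) else 1) := by
      rw [Finset.prod_ite, Finset.prod_const, Finset.prod_const_one, mul_one]
    rw [this, ← Finset.prod_mul_distrib]
    refine Finset.prod_congr rfl fun p _ => ?_
    generalize c * (p.1 : ℤ) + d * p.2 = u
    by_cases h : u = (n : ℤ) - (w + 1)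
    · rw [if_pos h, if_neg (by omega), if_pos (by omega), h, mul_one]
      congr 2 <;> ring
    · rw [if_neg h, one_mul]
      by_cases h' : u ≤ (n : ℤ) - w - 1
      · rw [if_pos h', if_pos (by omega)]
      · rw [if_neg h', if_neg (by omega)]

lemma tele (f : ℕ → ℚ) (hf : ∀ i, f i ≠ 0) (M : ℕ) :
    ∏ i ∈ range M, f i / f (i + 1) = f 0 / f M := by
  induction M with
  | zero => simp [hf 0]
  | succ M ih => rw [Finset.prod_range_succ, ih]; have := hf M; have := hf (M + 1); field_simp

lemma telescope (ha : 0 < a) (hb : 0 < b) (hc : 0 < c) (hd : 0 < d)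
    (hcd : c + d = N) (hnz : ∀ i, x i ≠ 0) (h1 : ∀ k ≤ N, x k = 1)
    (n M : ℕ) (hM : n < M) :
    ∏ p ∈ range M ×ˢ range M, (sR x N (n - (c * p.1 + d * p.2)) / sP x c d (n - (c * p.1 + d * p.2)))
      = x (n + N) := by
  rw [Finset.prod_product]
  have cM : (M : ℤ) ≤ c * M := by nlinarith
  have dM : (M : ℤ) ≤ d * M := by nlinarith
  have inner : ∀ r : ℕ, ∏ s ∈ range M, (sR x N (n - (c * (r:ℤ) + d * (s:ℤ))) / sP x c d (n - (c * (r:ℤ) + d * (s:ℤ))))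
      = x (n + N - c * (r:ℤ)) / x (n + N - c * ((r + 1 : ℕ) : ℤ)) := by
    intro r
    have e : ∀ s ∈ range M, sR x N (n - (c * (r:ℤ) + d * (s:ℤ))) / sP x c d (n - (c * (r:ℤ) + d * (s:ℤ)))
        = (fun s : ℕ => x (n - c * r + N - d * s) / x (n - c * r + d - d * s)) s /
          (fun s : ℕ => x (n - c * r + N - d * s) / x (n - c * r + d - d * s)) (s + 1) := by
      intro s _
      simp only
      unfold sR sP
      push_cast
      rw [show (n:ℤ) - (c * r + d * s) + N = n - c * r + N - d * s by ring,
        show (n:ℤ) - (c * r + d * s) + d = n - c * r + d - d * s by ring,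
        show (n:ℤ) - c * r + N - d * (s + 1) = n - (c * r + d * s) + c by rw [← hcd]; ring,
        show (n:ℤ) - c * r + d - d * (s + 1) = n - (c * r + d * s) by ring]
      have := hnz (n - (c * r + d * s))
      have := hnz (n - (c * r + d * s) + c)
      have := hnz (n - c * r + d - d * s)
      field_simp
    rw [Finset.prod_congr rfl e, tele _ (fun s => div_ne_zero (hnz _) (hnz _))]
    have cr : 0 ≤ c * (r : ℤ) := by positivity
    rw [h1 (n - c * r + N - d * M) (by omega), h1 (n - c * r + d - d * M) (by omega)]
    push_cast
    rw [show (n:ℤ) - c * r + N - d * 0 = n + N - c * r by ring,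
      show (n:ℤ) - c * r + d - d * 0 = n + N - c * (r + 1) by rw [← hcd]; ring]
    simp
  simp only [inner]
  rw [tele (fun r : ℕ => x (n + N - c * (r:ℤ))) (fun r => hnz _)]
  rw [h1 (n + N - c * M) (by omega)]
  simp

lemma core (ha : 0 < a) (hb : 0 < b) (hc : 0 < c) (hd : 0 < d)
    (hab : a + b = N) (hcd : c + d = N) (hnz : ∀ i, x i ≠ 0) (h1 : ∀ k ≤ N, x k = 1)
    (hrec : ∀ k, 1 ≤ k → sR x N k = sP x a b k + sP x c d k) (n : ℕ) :
    x (n + N) = ((Ideals (slab a b c d (n - N) (n - 1))).card : ℚ) := by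
  have hG := G_prod ha hb hc hd hab hcd hnz hrec n (n + 1) (by omega) n 0 le_rfl (by simp)
  have e1 : GG x a b c d N n 0 = ((Ideals (slab a b c d (n - N) (n - 1))).card : ℚ) := by
    unfold GG
    rw [sub_zero, Finset.card_eq_sum_ones, Nat.cast_sum]
    refine Finset.sum_congr rfl fun I hI => ?_
    rw [Nat.cast_one]
    refine Finset.prod_eq_one fun l hl => ?_
    apply y_zero ha hb hc hd hab hcd h1
    have := (mem_slab ha hb hc hd l).1 ((mem_Ideals.1 hI).1 hl)
    omega
  rw [← e1, hG, ← telescope ha hb hc hd hcd hnz h1 n (n + 1) (by omega)]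
  refine Finset.prod_congr rfl fun p _ => ?_
  split_ifs with h
  · rfl
  · unfold sR sP
    rw [h1 _ (by omega), h1 _ (by omega), h1 _ (by omega), h1 _ (by omega)]
    simp

end
end GR

/-- Let `a+b = N = c+d` with `gcd(a,c,N) = 1` and `{a,b} ≠ {c,d}`, and
let `x : ℤ → ℚ` be a nowhere-zero sequence with `x_i = 1` for `1 ≤ i ≤ N` satisfying the
Gale–Robinson recurrence.  Then for every `j > 0`, `x_{N+j}` equals the number of order
ideals of the finite poset `S^{(j)}`. -/
theorem galeRobinson_eq_card_orderIdeals (a b c d N : ℤ)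
    (ha : 0 < a) (hb : 0 < b) (hc : 0 < c) (hd : 0 < d)
    (hab : a + b = N) (hcd : c + d = N)
    (hgcd : Int.gcd a (Int.gcd c N) = 1)
    (hne : ({a, b} : Set ℤ) ≠ ({c, d} : Set ℤ))
    (x : ℤ → ℚ)
    (hinit : ∀ i : ℤ, 1 ≤ i → i ≤ N → x i = 1)
    (hnz : ∀ i : ℤ, x i ≠ 0)
    (hrec : ∀ i : ℤ, x i * x (i + N) = x (i + a) * x (i + N - a) + x (i + c) * x (i + N - c))
    (j : ℤ) (hj : 0 < j) :
    x (N + j) =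
      (Nat.card {I : Set V4 // I ⊆ Sj a b c d N j ∧
        ∀ m ∈ I, ∀ l ∈ Sj a b c d N j, l ≤ m → l ∈ I} : ℚ) := by
  classical
  obtain ⟨n, rfl⟩ : ∃ n : ℕ, j = n := ⟨j.toNat, by omega⟩
  have hx := GR.core (x := fun k => if k ≤ N then 1 else x k) ha hb hc hd hab hcd
    (by intro i; split_ifs
        · exact one_ne_zero
        · exact hnz i)
    (by intro k hk; simp [hk])
    (by
      have hx' : ∀ i : ℤ, 1 ≤ i → (if i ≤ N then (1 : ℚ) else x i) = x i := by
        intro i hi; split_ifs with h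
        · exact (hinit i hi h).symm
        · rfl
      intro k hk
      simp only [GR.sR, GR.sP]
      rw [hx' k hk, hx' (k + N) (by omega), hx' (k + a) (by omega), hx' (k + b) (by omega),
        hx' (k + c) (by omega), hx' (k + d) (by omega), hrec k,
        show k + N - a = k + b by omega, show k + N - c = k + d by omega]) n
  rw [if_neg (by omega), add_comm] at hx
  rw [hx]
  congr 1
  have hS : ∀ l : V4, l ∈ GR.slab a b c d (n - N) (n - 1) ↔ l ∈ Sj a b c d N n := by
    intro l; rw [GR.mem_slab ha hb hc hd]; rfl
  rw [← Nat.card_eq_finsetCard]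
  refine Nat.card_eq_of_bijective (fun I => ⟨(I.1 : Set V4), ?_, ?_⟩) ⟨?_, ?_⟩
  · intro l hl
    exact (hS l).1 ((GR.mem_Ideals.1 I.2).1 hl)
  · intro m hm l hl hlm
    exact (GR.mem_Ideals.1 I.2).2 m hm l ((hS l).2 hl) hlm
  · intro I J h
    have := congrArg Subtype.val h
    exact Subtype.ext (Finset.coe_injective this)
  · rintro ⟨I, h1, h2⟩
    have hfin : I.Finite := (GR.slab a b c d (n - N) (n - 1)).finite_toSet.subset
      (fun l hl => (hS l).2 (h1 hl))
    refine ⟨⟨hfin.toFinset, GR.mem_Ideals.2 ⟨?_, ?_⟩⟩, ?_⟩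
    · intro l hl
      exact (hS l).2 (h1 (hfin.mem_toFinset.1 hl))
    · intro m hm l hl hlm
      exact hfin.mem_toFinset.2 (h2 m (hfin.mem_toFinset.1 hm) l ((hS l).1 hl) hlm)
    · apply Subtype.ext
      simp
end

section
/- Let a, b, c, d, N be positive integers with a + b = N = c + d, gcd(a, c, N) = 1, and {a, b} ≠ {c, d}. Let x : ℤ → ℚ be a sequence satisfying x_i = 1 for 1 ≤ i ≤ N, x_i ≠ 0 for all i ∈ ℤ, and the Gale–Robinson recurrence x_i · x_{i+N} = x_{i+a} · x_{i+N−a} + x_{i+c} · x_{i+N−c} for all i ∈ ℤ. Then for every integer j > 0, x_{1−j} equals the number of order filters of the finite poset S^{(j)}. -/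
/-- filter predicate -/
def GRIsF (P R : Finset V4) : Prop := ∀ l ∈ R, ∀ m ∈ P, l ≤ m → m ∈ R

open Classical in
/-- weighted count of filters -/
noncomputable def GRZ (P : Finset V4) (y : V4 → ℚ) : ℚ :=
  ∑ R ∈ P.powerset, if GRIsF P R then ∏ l ∈ R, y l else 0

open Classical in
/-- local weight -/
noncomputable def GRw (M Q : Finset V4) (y : V4 → ℚ) (v : V4) : ℚ :=
  (if ∃ m ∈ M, v ≤ m ∧ m ∉ Q then 0 else y v) + (if ∃ m ∈ M, m ≤ v ∧ m ∈ Q then 0 else 1)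

theorem GR_isF_iff (M B Q T : Finset V4) (hMB : Disjoint M B) (hQ : Q ⊆ M) (hT : T ⊆ B)
    (hB : ∀ v ∈ B, ∀ w ∈ B, v ≤ w → v ≠ w → ∃ m ∈ M, v ≤ m ∧ m ≤ w) :
    GRIsF (M ∪ B) (Q ∪ T) ↔ GRIsF M Q ∧ (∀ v ∈ T, ¬ ∃ m ∈ M, v ≤ m ∧ m ∉ Q) ∧
      (∀ v ∈ B \ T, ¬ ∃ m ∈ M, m ≤ v ∧ m ∈ Q) := by
  rw [Finset.disjoint_left] at hMB
  constructor
  · intro h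
    refine ⟨?_, ?_, ?_⟩
    · intro l hl m hm hlm
      have := h l (Finset.mem_union_left _ hl) m (Finset.mem_union_left _ hm) hlm
      rcases Finset.mem_union.1 this with h1 | h1
      · exact h1
      · exact absurd (hT h1) (hMB hm)
    · rintro v hv ⟨m, hm, hvm, hmQ⟩
      have := h v (Finset.mem_union_right _ hv) m (Finset.mem_union_left _ hm) hvm
      rcases Finset.mem_union.1 this with h1 | h1
      · exact hmQ h1
      · exact absurd (hT h1) (hMB hm)
    · rintro v hv ⟨m, hm, hvm, hmQ⟩
      rw [Finset.mem_sdiff] at hv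
      have := h m (Finset.mem_union_left _ hmQ) v (Finset.mem_union_right _ hv.1) hvm
      rcases Finset.mem_union.1 this with h1 | h1
      · exact hMB (hQ h1) hv.1
      · exact hv.2 h1
  · rintro ⟨h1, h2, h3⟩ l hl m hm hlm
    rcases Finset.mem_union.1 hl with hl | hl <;> rcases Finset.mem_union.1 hm with hm | hm
    · exact Finset.mem_union_left _ (h1 l hl m hm hlm)
    · by_contra hc
      have hmT : m ∉ T := fun h => hc (Finset.mem_union_right _ h)
      exact h3 m (Finset.mem_sdiff.2 ⟨hm, hmT⟩) ⟨l, hQ hl, hlm, hl⟩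
    · by_contra hc
      have hmQ : m ∉ Q := fun h => hc (Finset.mem_union_left _ h)
      exact h2 l hl ⟨m, hm, hlm, hmQ⟩
    · by_cases e : l = m
      · subst e; exact Finset.mem_union_right _ hl
      · obtain ⟨k, hk, hlk, hkm⟩ := hB l (hT hl) m hm hlm e
        have hkQ : k ∈ Q := by
          by_contra hc
          exact h2 l hl ⟨k, hk, hlk, hc⟩
        by_contra hc
        have hmT : m ∉ T := fun h => hc (Finset.mem_union_right _ h)
        exact h3 m (Finset.mem_sdiff.2 ⟨hm, hmT⟩) ⟨k, hk, hkm, hkQ⟩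

theorem GR_sum_powerset_union (M B : Finset V4) (hMB : Disjoint M B) (F : Finset V4 → ℚ) :
    ∑ R ∈ (M ∪ B).powerset, F R = ∑ Q ∈ M.powerset, ∑ T ∈ B.powerset, F (Q ∪ T) := by
  rw [Finset.disjoint_left] at hMB
  rw [← Finset.sum_product']
  symm
  refine Finset.sum_bij' (fun p _ => p.1 ∪ p.2) (fun R _ => (R ∩ M, R ∩ B)) ?_ ?_ ?_ ?_ ?_
  · rintro ⟨Q, T⟩ h
    simp only [Finset.mem_product, Finset.mem_powerset] at h ⊢
    exact Finset.union_subset_union h.1 h.2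
  · intro R h
    simp
  · rintro ⟨Q, T⟩ h
    simp only [Finset.mem_product, Finset.mem_powerset] at h
    have h1 := h.1
    have h2 := h.2
    ext u <;> simp only [Finset.mem_inter, Finset.mem_union]
    · have := @h1 u; have := @h2 u; have := @hMB u; tauto
    · have := @h1 u; have := @h2 u; have := @hMB u; tauto
  · intro R h
    simp only [Finset.mem_powerset] at h
    ext u
    have := @h u
    simp only [Finset.mem_inter, Finset.mem_union] at *
    tauto
  · intros; rfl

open Classical in
theorem GR_Z_union (M B : Finset V4) (y : V4 → ℚ) (hMB : Disjoint M B)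
    (hB : ∀ v ∈ B, ∀ w ∈ B, v ≤ w → v ≠ w → ∃ m ∈ M, v ≤ m ∧ m ≤ w) :
    GRZ (M ∪ B) y = ∑ Q ∈ M.powerset,
      if GRIsF M Q then (∏ l ∈ Q, y l) * ∏ v ∈ B, GRw M Q y v else 0 := by
  unfold GRZ
  rw [GR_sum_powerset_union M B hMB]
  refine Finset.sum_congr rfl fun Q hQ => ?_
  rw [Finset.mem_powerset] at hQ
  by_cases hF : GRIsF M Q
  · rw [if_pos hF]
    unfold GRw
    rw [Finset.prod_add, Finset.mul_sum]
    refine Finset.sum_congr rfl fun T hT => ?_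
    rw [Finset.mem_powerset] at hT
    have hd : Disjoint Q T := Finset.disjoint_of_subset_left hQ (Finset.disjoint_of_subset_right hT hMB)
    have key := GR_isF_iff M B Q T hMB hQ hT hB
    by_cases h : GRIsF (M ∪ B) (Q ∪ T)
    · rw [if_pos h, Finset.prod_union hd]
      obtain ⟨-, h2, h3⟩ := key.1 h
      congr 1
      rw [Finset.prod_congr rfl (fun v hv => if_neg (h2 v hv)),
        Finset.prod_congr rfl (fun v hv => if_neg (h3 v hv))]
      simp
    · rw [if_neg h]
      have : ¬ ((∀ v ∈ T, ¬ ∃ m ∈ M, v ≤ m ∧ m ∉ Q) ∧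
        (∀ v ∈ B \ T, ¬ ∃ m ∈ M, m ≤ v ∧ m ∈ Q)) := fun h' => h (key.2 ⟨hF, h'⟩)
      rw [not_and_or] at this
      symm
      rcases this with h' | h'
      · push Not at h'
        obtain ⟨v, hv, h'⟩ := h'
        have hz : ∏ i ∈ T, (if ∃ m ∈ M, i ≤ m ∧ m ∉ Q then 0 else y i) = 0 :=
          Finset.prod_eq_zero hv (if_pos h')
        rw [hz]; simp
      · push Not at h'
        obtain ⟨v, hv, h'⟩ := h'
        exact mul_eq_zero_of_right _ (mul_eq_zero_of_right _ (Finset.prod_eq_zero hv (if_pos h')))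
  · rw [if_neg hF]
    refine Finset.sum_eq_zero fun T hT => ?_
    rw [Finset.mem_powerset] at hT
    rw [if_neg]
    intro h
    exact hF ((GR_isF_iff M B Q T hMB hQ hT hB).1 h).1

/-- the cone -/
def GRC (l : V4) : Prop := 0 ≤ l 0 ∧ 0 ≤ l 1 ∧ l 2 ≤ 0 ∧ l 3 ≤ 0

open Classical in
/-- levels between lo and hi in the cone -/
noncomputable def GRP (a b c d lo hi : ℤ) : Finset V4 :=
  (Finset.Icc (fun _ => -hi) (fun _ => hi) : Finset V4).filter
    (fun l => lo ≤ linS a b c d l ∧ linS a b c d l ≤ hi ∧ GRC l)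

open Classical in
theorem GR_mem (a b c d lo hi : ℤ) (ha : 0 < a) (hb : 0 < b) (hc : 0 < c) (hd : 0 < d) (l : V4) :
    l ∈ GRP a b c d lo hi ↔ lo ≤ linS a b c d l ∧ linS a b c d l ≤ hi ∧ GRC l := by
  unfold GRP
  rw [Finset.mem_filter, and_iff_right_iff_imp]
  rintro ⟨-, h2, h3, h4, h5, h6⟩
  unfold linS at h2
  have e0 : l 0 ≤ a * l 0 := by nlinarith
  have e1 : l 1 ≤ b * l 1 := by nlinarith
  have e2 : -l 2 ≤ -(c * l 2) := by nlinarith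
  have e3 : -l 3 ≤ -(d * l 3) := by nlinarith
  rw [Finset.mem_Icc]
  constructor <;> intro i <;> fin_cases i <;> simp <;> linarith

/-- basis shift -/
def GRs (p q r s : ℤ) (l : V4) : V4 := ![l 0 + p, l 1 + q, l 2 + r, l 3 + s]

theorem GR_lin_s (a b c d p q r s : ℤ) (l : V4) :
    linS a b c d (GRs p q r s l) = linS a b c d l + (a * p + b * q - c * r - d * s) := by
  simp [linS, GRs]; ring

theorem GR_le (l m : V4) : l ≤ m ↔ l 0 ≤ m 0 ∧ l 1 ≤ m 1 ∧ l 2 ≤ m 2 ∧ l 3 ≤ m 3 := by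
  rw [Pi.le_def]
  simp [Fin.forall_fin_succ]

theorem GR_ext (l m : V4) : l = m ↔ l 0 = m 0 ∧ l 1 = m 1 ∧ l 2 = m 2 ∧ l 3 = m 3 := by
  rw [funext_iff]
  simp [Fin.forall_fin_succ]

theorem GR_s0 (p q r s : ℤ) (l : V4) : GRs p q r s l 0 = l 0 + p := rfl
theorem GR_s1 (p q r s : ℤ) (l : V4) : GRs p q r s l 1 = l 1 + q := rfl
theorem GR_s2 (p q r s : ℤ) (l : V4) : GRs p q r s l 2 = l 2 + r := rfl
theorem GR_s3 (p q r s : ℤ) (l : V4) : GRs p q r s l 3 = l 3 + s := rfl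

theorem GR_s_s (p q r s p' q' r' s' : ℤ) (l : V4) :
    GRs p q r s (GRs p' q' r' s' l) = GRs (p'+p) (q'+q) (r'+r) (s'+s) l := by
  rw [GR_ext]; simp only [GR_s0, GR_s1, GR_s2, GR_s3]; omega

theorem GR_s_zero (l : V4) : GRs 0 0 0 0 l = l := by
  rw [GR_ext]; simp only [GR_s0, GR_s1, GR_s2, GR_s3]; omega

/-- moving up in the order without decreasing the level uses an `a` or `b` step -/
theorem GR_up (a b c d : ℤ) (hc : 0 < c) (hd : 0 < d) (v m : V4)
    (hvm : v ≤ m) (hne : v ≠ m) (hL : linS a b c d v ≤ linS a b c d m) :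
    GRs 1 0 0 0 v ≤ m ∨ GRs 0 1 0 0 v ≤ m := by
  rw [GR_le] at *
  rw [GR_le]
  rw [Ne, GR_ext] at hne
  simp only [GR_s0, GR_s1, GR_s2, GR_s3]
  by_contra h
  have h0 : m 0 = v 0 := by omega
  have h1 : m 1 = v 1 := by omega
  unfold linS at hL
  rw [h0, h1] at hL
  have e2 : 0 ≤ c * (m 2 - v 2) := mul_nonneg hc.le (by omega)
  have e3 : 0 ≤ d * (m 3 - v 3) := mul_nonneg hd.le (by omega)
  have f2 : c * (m 2 - v 2) = 0 := by linarith
  have f3 : d * (m 3 - v 3) = 0 := by linarith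
  rcases mul_eq_zero.1 f2 with f2 | f2
  · omega
  rcases mul_eq_zero.1 f3 with f3 | f3 <;> omega

theorem GR_up' (a b c d : ℤ) (hc : 0 < c) (hd : 0 < d) (v m : V4)
    (hvm : v ≤ m) (hne : v ≠ m) (hL : linS a b c d v ≤ linS a b c d m) :
    v ≤ GRs (-1) 0 0 0 m ∨ v ≤ GRs 0 (-1) 0 0 m := by
  have := GR_up a b c d hc hd v m hvm hne hL
  simp only [GR_le, GR_s0, GR_s1, GR_s2, GR_s3] at *
  omega

/-- moving up in the order without increasing the level uses a `c` or `d` step -/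
theorem GR_dn (a b c d : ℤ) (ha : 0 < a) (hb : 0 < b) (v m : V4)
    (hvm : v ≤ m) (hne : v ≠ m) (hL : linS a b c d m ≤ linS a b c d v) :
    GRs 0 0 1 0 v ≤ m ∨ GRs 0 0 0 1 v ≤ m := by
  rw [GR_le] at *
  rw [GR_le]
  rw [Ne, GR_ext] at hne
  simp only [GR_s0, GR_s1, GR_s2, GR_s3]
  by_contra h
  have h0 : m 2 = v 2 := by omega
  have h1 : m 3 = v 3 := by omega
  unfold linS at hL
  rw [h0, h1] at hL
  have e2 : 0 ≤ a * (m 0 - v 0) := mul_nonneg ha.le (by omega)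
  have e3 : 0 ≤ b * (m 1 - v 1) := mul_nonneg hb.le (by omega)
  have f2 : a * (m 0 - v 0) = 0 := by linarith
  have f3 : b * (m 1 - v 1) = 0 := by linarith
  rcases mul_eq_zero.1 f2 with f2 | f2
  · omega
  rcases mul_eq_zero.1 f3 with f3 | f3 <;> omega

theorem GR_dn' (a b c d : ℤ) (ha : 0 < a) (hb : 0 < b) (v m : V4)
    (hvm : v ≤ m) (hne : v ≠ m) (hL : linS a b c d m ≤ linS a b c d v) :
    v ≤ GRs 0 0 (-1) 0 m ∨ v ≤ GRs 0 0 0 (-1) m := by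
  have := GR_dn a b c d ha hb v m hvm hne hL
  simp only [GR_le, GR_s0, GR_s1, GR_s2, GR_s3] at *
  omega

section GRstep
variable (a b c d N k : ℤ)

open Classical in
theorem GR_botW (ha : 0 < a) (hb : 0 < b) (hc : 0 < c) (hd : 0 < d) (hab : a + b = N)
    (hcd : c + d = N) (Q : Finset V4) (hQ : Q ⊆ GRP a b c d (k-N+1) (k-1))
    (hF : GRIsF (GRP a b c d (k-N+1) (k-1)) Q) (y : V4 → ℚ) (y0 : ℚ) (h1 : 1 + y0 ≠ 0)
    (v : V4) (hv : v ∈ GRP a b c d (k-N) (k-N)) (hy : y v = y0) :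
    GRw (GRP a b c d (k-N+1) (k-1)) Q y v =
      (if GRs 1 0 0 0 v ∈ Q ∧ GRs 0 1 0 0 v ∈ Q then 1 + y0 else 1) *
      (if GRs 0 0 (-1) 0 v ∈ Q ∨ GRs 0 0 0 (-1) v ∈ Q then y0 / (1 + y0) else 1) := by
  set M := GRP a b c d (k-N+1) (k-1) with hM
  have mem : ∀ l, l ∈ M ↔ _ := GR_mem a b c d (k-N+1) (k-1) ha hb hc hd
  rw [GR_mem a b c d _ _ ha hb hc hd] at hv
  obtain ⟨hv1, hv2, hv3⟩ := hv
  have m1 : GRs 1 0 0 0 v ∈ M := by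
    rw [mem, GR_lin_s]; unfold GRC at *; simp only [GR_s0, GR_s1, GR_s2, GR_s3]; omega
  have m2 : GRs 0 1 0 0 v ∈ M := by
    rw [mem, GR_lin_s]; unfold GRC at *; simp only [GR_s0, GR_s1, GR_s2, GR_s3]; omega
  have m3 : GRs 0 0 (-1) 0 v ∈ M := by
    rw [mem, GR_lin_s]; unfold GRC at *; simp only [GR_s0, GR_s1, GR_s2, GR_s3]; omega
  have m4 : GRs 0 0 0 (-1) v ∈ M := by
    rw [mem, GR_lin_s]; unfold GRC at *; simp only [GR_s0, GR_s1, GR_s2, GR_s3]; omega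
  have vM : ∀ m ∈ M, v ≠ m ∧ linS a b c d v ≤ linS a b c d m := by
    intro m hm
    rw [mem] at hm
    refine ⟨?_, by omega⟩
    rintro rfl
    omega
  have FO : (∃ m ∈ M, v ≤ m ∧ m ∉ Q) ↔ ¬ (GRs 1 0 0 0 v ∈ Q ∧ GRs 0 1 0 0 v ∈ Q) := by
    constructor
    · rintro ⟨m, hm, hvm, hmQ⟩ ⟨q1, q2⟩
      rcases GR_up a b c d hc hd v m hvm (vM m hm).1 (vM m hm).2 with h | h
      · exact hmQ (hF _ q1 _ hm h)
      · exact hmQ (hF _ q2 _ hm h)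
    · intro h
      rw [not_and_or] at h
      rcases h with h | h
      · exact ⟨_, m1, by simp only [GR_le, GR_s0, GR_s1, GR_s2, GR_s3]; omega, h⟩
      · exact ⟨_, m2, by simp only [GR_le, GR_s0, GR_s1, GR_s2, GR_s3]; omega, h⟩
  have FI : (∃ m ∈ M, m ≤ v ∧ m ∈ Q) ↔ (GRs 0 0 (-1) 0 v ∈ Q ∨ GRs 0 0 0 (-1) v ∈ Q) := by
    constructor
    · rintro ⟨m, hm, hvm, hmQ⟩
      rcases GR_dn' a b c d ha hb m v hvm (vM m hm).1.symm (vM m hm).2 with h | h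
      · exact Or.inl (hF _ hmQ _ m3 h)
      · exact Or.inr (hF _ hmQ _ m4 h)
    · rintro (h | h)
      · exact ⟨_, m3, by simp only [GR_le, GR_s0, GR_s1, GR_s2, GR_s3]; omega, h⟩
      · exact ⟨_, m4, by simp only [GR_le, GR_s0, GR_s1, GR_s2, GR_s3]; omega, h⟩
  have ex : (∃ m ∈ M, m ≤ v ∧ m ∈ Q) → ¬ (∃ m ∈ M, v ≤ m ∧ m ∉ Q) := by
    rintro ⟨m, hm, h, hq⟩ ⟨m', hm', h', hq'⟩
    exact hq' (hF m hq m' hm' (h.trans h'))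
  rw [FO, FI] at ex
  unfold GRw
  simp only [FO, FI, hy]
  by_cases A : GRs 1 0 0 0 v ∈ Q ∧ GRs 0 1 0 0 v ∈ Q <;>
  by_cases B : GRs 0 0 (-1) 0 v ∈ Q ∨ GRs 0 0 0 (-1) v ∈ Q
  · rw [if_neg (not_not.2 A), if_pos B, if_pos A, if_pos B]; field_simp; simp
  · rw [if_neg (not_not.2 A), if_neg B, if_pos A, if_neg B]; ring
  · exact absurd A (ex B)
  · rw [if_pos A, if_neg B, if_neg A, if_neg B]; ring

open Classical in
theorem GR_topW (ha : 0 < a) (hb : 0 < b) (hc : 0 < c) (hd : 0 < d) (hab : a + b = N)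
    (hcd : c + d = N) (Q : Finset V4) (hQ : Q ⊆ GRP a b c d (k-N+1) (k-1))
    (hF : GRIsF (GRP a b c d (k-N+1) (k-1)) Q) (y : V4 → ℚ) (y0 : ℚ) (h0 : y0 ≠ 0)
    (h1 : 1 + y0 ≠ 0)
    (v : V4) (hv : v ∈ GRP a b c d k k) (hy : y v = y0⁻¹) :
    GRw (GRP a b c d (k-N+1) (k-1)) Q y v =
      (if GRs (-1) 0 0 0 v ∈ Q ∨ GRs 0 (-1) 0 0 v ∈ Q then (1 + y0)⁻¹ else 1) *
      (if (v 2 < 0 → GRs 0 0 1 0 v ∈ Q) ∧ (v 3 < 0 → GRs 0 0 0 1 v ∈ Q)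
        then (y0 / (1 + y0))⁻¹ else 1) := by
  set M := GRP a b c d (k-N+1) (k-1) with hM
  have mem : ∀ l, l ∈ M ↔ _ := GR_mem a b c d (k-N+1) (k-1) ha hb hc hd
  rw [GR_mem a b c d _ _ ha hb hc hd] at hv
  obtain ⟨hv1, hv2, hv3⟩ := hv
  have m1 : 0 < v 0 → GRs (-1) 0 0 0 v ∈ M := by
    rw [mem, GR_lin_s]; unfold GRC at *; simp only [GR_s0, GR_s1, GR_s2, GR_s3]; omega
  have m2 : 0 < v 1 → GRs 0 (-1) 0 0 v ∈ M := by
    rw [mem, GR_lin_s]; unfold GRC at *; simp only [GR_s0, GR_s1, GR_s2, GR_s3]; omega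
  have m3 : v 2 < 0 → GRs 0 0 1 0 v ∈ M := by
    rw [mem, GR_lin_s]; unfold GRC at *; simp only [GR_s0, GR_s1, GR_s2, GR_s3]; omega
  have m4 : v 3 < 0 → GRs 0 0 0 1 v ∈ M := by
    rw [mem, GR_lin_s]; unfold GRC at *; simp only [GR_s0, GR_s1, GR_s2, GR_s3]; omega
  have vM : ∀ m ∈ M, v ≠ m ∧ linS a b c d m ≤ linS a b c d v ∧ GRC m := by
    intro m hm
    rw [mem] at hm
    refine ⟨?_, by omega, hm.2.2⟩
    rintro rfl
    omega
  have FO : (∃ m ∈ M, v ≤ m ∧ m ∉ Q) ↔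
      ¬ ((v 2 < 0 → GRs 0 0 1 0 v ∈ Q) ∧ (v 3 < 0 → GRs 0 0 0 1 v ∈ Q)) := by
    constructor
    · rintro ⟨m, hm, hvm, hmQ⟩ ⟨q1, q2⟩
      have hC := (vM m hm).2.2
      unfold GRC at hC
      rcases GR_dn a b c d ha hb v m hvm (vM m hm).1 (vM m hm).2.1 with h | h
      · have h' := h
        simp only [GR_le, GR_s0, GR_s1, GR_s2, GR_s3] at h'
        exact hmQ (hF _ (q1 (by omega)) _ hm h)
      · have h' := h
        simp only [GR_le, GR_s0, GR_s1, GR_s2, GR_s3] at h'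
        exact hmQ (hF _ (q2 (by omega)) _ hm h)
    · intro h
      rw [not_and_or] at h
      rcases h with h | h <;> rw [Classical.not_imp] at h
      · exact ⟨_, m3 h.1, by simp only [GR_le, GR_s0, GR_s1, GR_s2, GR_s3]; omega, h.2⟩
      · exact ⟨_, m4 h.1, by simp only [GR_le, GR_s0, GR_s1, GR_s2, GR_s3]; omega, h.2⟩
  have FI : (∃ m ∈ M, m ≤ v ∧ m ∈ Q) ↔ (GRs (-1) 0 0 0 v ∈ Q ∨ GRs 0 (-1) 0 0 v ∈ Q) := by
    constructor
    · rintro ⟨m, hm, hvm, hmQ⟩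
      have hC := (vM m hm).2.2
      unfold GRC at hC
      rcases GR_up' a b c d hc hd m v hvm (vM m hm).1.symm (vM m hm).2.1 with h | h
      · have h' := h
        simp only [GR_le, GR_s0, GR_s1, GR_s2, GR_s3] at h'
        exact Or.inl (hF _ hmQ _ (m1 (by omega)) h)
      · have h' := h
        simp only [GR_le, GR_s0, GR_s1, GR_s2, GR_s3] at h'
        exact Or.inr (hF _ hmQ _ (m2 (by omega)) h)
    · rintro (h | h)
      · exact ⟨_, hQ h, by simp only [GR_le, GR_s0, GR_s1, GR_s2, GR_s3]; omega, h⟩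
      · exact ⟨_, hQ h, by simp only [GR_le, GR_s0, GR_s1, GR_s2, GR_s3]; omega, h⟩
  have ex : (∃ m ∈ M, m ≤ v ∧ m ∈ Q) → ¬ (∃ m ∈ M, v ≤ m ∧ m ∉ Q) := by
    rintro ⟨m, hm, h, hq⟩ ⟨m', hm', h', hq'⟩
    exact hq' (hF m hq m' hm' (h.trans h'))
  rw [FO, FI] at ex
  unfold GRw
  simp only [FO, FI, hy]
  by_cases A : (v 2 < 0 → GRs 0 0 1 0 v ∈ Q) ∧ (v 3 < 0 → GRs 0 0 0 1 v ∈ Q) <;>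
  by_cases B : GRs (-1) 0 0 0 v ∈ Q ∨ GRs 0 (-1) 0 0 v ∈ Q
  · rw [if_neg (not_not.2 A), if_pos B, if_pos A, if_pos B]; field_simp; simp
  · rw [if_neg (not_not.2 A), if_neg B, if_pos A, if_neg B]; field_simp
  · exact absurd A (ex B)
  · rw [if_pos A, if_neg B, if_neg A, if_neg B]; ring

open Classical in
theorem GR_prodQ (ha : 0 < a) (hb : 0 < b) (hc : 0 < c) (hd : 0 < d)
    (Q : Finset V4) (o : ℚ) (p q r s t : ℤ)
    (hst : t + (a * p + b * q - c * r - d * s) = k)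
    (hC : ∀ l ∈ Q, GRC (GRs p q r s l)) :
    ∏ l ∈ Q, (if linS a b c d l = t then o else 1) =
      ∏ v ∈ GRP a b c d k k, (if GRs (-p) (-q) (-r) (-s) v ∈ Q then o else 1) := by
  rw [← Finset.prod_filter]
  refine Finset.prod_of_injOn (GRs p q r s) ?_ ?_ ?_ ?_
  · intro l _ m _ h
    simp only [GR_ext, GR_s0, GR_s1, GR_s2, GR_s3] at h ⊢
    omega
  · intro l hl
    simp only [Finset.coe_filter, Set.mem_ofPred_eq] at hl
    simp only [Finset.mem_coe, GR_mem a b c d _ _ ha hb hc hd]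
    refine ⟨?_, ?_, hC l hl.1⟩ <;> rw [GR_lin_s] <;> linarith [hl.2]
  · intro v hv hn
    rw [GR_mem a b c d _ _ ha hb hc hd] at hv
    rw [if_neg]
    intro h
    apply hn
    refine ⟨GRs (-p) (-q) (-r) (-s) v, ?_, ?_⟩
    · simp only [Finset.coe_filter, Set.mem_ofPred_eq]
      refine ⟨h, ?_⟩
      rw [GR_lin_s]; linarith [hv.1, hv.2.1]
    · rw [GR_s_s]; simp [GR_s_zero]
  · intro l hl
    rw [Finset.mem_filter] at hl
    rw [if_pos]
    rw [GR_s_s]; simp [GR_s_zero, hl.1]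

open Classical in
theorem GR_prodBA (ha : 0 < a) (hb : 0 < b) (hc : 0 < c) (hd : 0 < d) (hab : a + b = N)
    (Q : Finset V4) (hQ : Q ⊆ GRP a b c d (k-N+1) (k-1)) (o : ℚ) :
    ∏ v ∈ GRP a b c d (k-N) (k-N), (if GRs 1 0 0 0 v ∈ Q ∧ GRs 0 1 0 0 v ∈ Q then o else 1) =
      ∏ v ∈ GRP a b c d k k, (if GRs 0 (-1) 0 0 v ∈ Q ∧ GRs (-1) 0 0 0 v ∈ Q then o else 1) := by
  refine Finset.prod_of_injOn (GRs 1 1 0 0) ?_ ?_ ?_ ?_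
  · intro l _ m _ h
    simp only [GR_ext, GR_s0, GR_s1, GR_s2, GR_s3] at h ⊢
    omega
  · intro l hl
    simp only [Finset.mem_coe, GR_mem a b c d _ _ ha hb hc hd, GR_lin_s, GRC,
      GR_s0, GR_s1, GR_s2, GR_s3] at hl ⊢
    omega
  · intro v hv hn
    rw [if_neg]
    rintro ⟨h1, h2⟩
    apply hn
    have h1 := hQ h1
    have h2 := hQ h2
    refine ⟨GRs (-1) (-1) 0 0 v, ?_, ?_⟩
    · simp only [Finset.mem_coe, GR_mem a b c d _ _ ha hb hc hd, GR_lin_s, GRC,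
        GR_s0, GR_s1, GR_s2, GR_s3] at *
      omega
    · rw [GR_s_s]; simp [GR_s_zero]
  · intro l hl
    simp only [GR_s_s]
    norm_num

open Classical in
theorem GR_prodBB (ha : 0 < a) (hb : 0 < b) (hc : 0 < c) (hd : 0 < d) (hcd : c + d = N)
    (Q : Finset V4) (o : ℚ) :
    ∏ v ∈ GRP a b c d (k-N) (k-N),
      (if GRs 0 0 (-1) 0 v ∈ Q ∨ GRs 0 0 0 (-1) v ∈ Q then o else 1) =
      ∏ v ∈ GRP a b c d k k, (if v 2 < 0 ∧ v 3 < 0 ∧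
        (GRs 0 0 0 1 v ∈ Q ∨ GRs 0 0 1 0 v ∈ Q) then o else 1) := by
  refine Finset.prod_of_injOn (GRs 0 0 (-1) (-1)) ?_ ?_ ?_ ?_
  · intro l _ m _ h
    simp only [GR_ext, GR_s0, GR_s1, GR_s2, GR_s3] at h ⊢
    omega
  · intro l hl
    simp only [Finset.mem_coe, GR_mem a b c d _ _ ha hb hc hd, GR_lin_s, GRC,
      GR_s0, GR_s1, GR_s2, GR_s3] at hl ⊢
    omega
  · intro v hv hn
    rw [if_neg]
    rintro ⟨h1, h2, -⟩
    apply hn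
    refine ⟨GRs 0 0 1 1 v, ?_, ?_⟩
    · simp only [Finset.mem_coe, GR_mem a b c d _ _ ha hb hc hd, GR_lin_s, GRC,
        GR_s0, GR_s1, GR_s2, GR_s3] at *
      omega
    · rw [GR_s_s]; simp [GR_s_zero]
  · intro l hl
    rw [GR_mem a b c d _ _ ha hb hc hd] at hl
    have h2 : l 2 + -1 < 0 := by have := hl.2.2.2.2.1; omega
    have h3 : l 3 + -1 < 0 := by have := hl.2.2.2.2.2; omega
    simp only [GR_s_s, GR_s2, GR_s3, h2, h3, true_and]
    norm_num

open Classical in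
theorem GR_local (ha : 0 < a) (hb : 0 < b) (hc : 0 < c) (hd : 0 < d) (hab : a + b = N)
    (hcd : c + d = N) (Q : Finset V4) (hQ : Q ⊆ GRP a b c d (k-N+1) (k-1))
    (hF : GRIsF (GRP a b c d (k-N+1) (k-1)) Q) (y y' : ℤ → ℚ)
    (h0 : y (k - N) ≠ 0) (h1 : 1 + y (k-N) ≠ 0) (hyk : y' k = (y (k-N))⁻¹)
    (hy : ∀ s, k - N + 1 ≤ s → s ≤ k - 1 → y' s = y s *
      ((if s = k - N + a then 1 + y (k-N) else 1) *
      (if s = k - N + b then 1 + y (k-N) else 1) *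
      (if s = k - N + c then y (k-N) / (1 + y (k-N)) else 1) *
      (if s = k - N + d then y (k-N) / (1 + y (k-N)) else 1))) :
    (∏ l ∈ Q, y (linS a b c d l)) * ∏ v ∈ GRP a b c d (k-N) (k-N),
      GRw (GRP a b c d (k-N+1) (k-1)) Q (fun l => y (linS a b c d l)) v =
    (y (k-N) / (1 + y (k-N))) ^ ((GRP a b c d k k).filter (fun v => v 2 = 0 ∧ v 3 = 0)).card *
    ((∏ l ∈ Q, y' (linS a b c d l)) * ∏ v ∈ GRP a b c d k k,
      GRw (GRP a b c d (k-N+1) (k-1)) Q (fun l => y' (linS a b c d l)) v) := by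
  have mem := fun lo hi => GR_mem a b c d lo hi ha hb hc hd
  have e1 : ∏ l ∈ Q, y' (linS a b c d l) = ∏ l ∈ Q, (y (linS a b c d l) * _) :=
    Finset.prod_congr rfl fun l hl => by
      have := (mem _ _ _).1 (hQ hl)
      exact hy _ this.1 this.2.1
  set y0 := y (k-N) with hy0
  have e2 := Finset.prod_congr (rfl : GRP a b c d (k-N) (k-N) = _)
    (fun v hv => GR_botW a b c d N k ha hb hc hd hab hcd Q hQ hF (fun l => y (linS a b c d l)) y0 h1
      v hv (by have := (mem _ _ _).1 hv
               rw [hy0]; congr 1; omega))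
  have e3 := Finset.prod_congr (rfl : GRP a b c d k k = _)
    (fun v hv => GR_topW a b c d N k ha hb hc hd hab hcd Q hQ hF (fun l => y' (linS a b c d l)) y0
      h0 h1
      v hv (by have := (mem _ _ _).1 hv
               rw [← hyk]; congr 1; omega))
  have hQC : ∀ l ∈ Q, GRC l := fun l hl => ((mem _ _ _).1 (hQ hl)).2.2
  rw [e1, e2, e3]
  simp only [Finset.prod_mul_distrib]
  rw [GR_prodBA a b c d N k ha hb hc hd hab Q hQ, GR_prodBB a b c d N k ha hb hc hd hcd Q]
  rw [GR_prodQ a b c d k ha hb hc hd Q _ 0 1 0 0 (k-N+a) (by linarith)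
    (fun l hl => by have := hQC l hl; simp only [GRC, GR_s0, GR_s1, GR_s2, GR_s3] at *; omega)]
  rw [GR_prodQ a b c d k ha hb hc hd Q _ 1 0 0 0 (k-N+b) (by linarith)
    (fun l hl => by have := hQC l hl; simp only [GRC, GR_s0, GR_s1, GR_s2, GR_s3] at *; omega)]
  rw [GR_prodQ a b c d k ha hb hc hd Q _ 0 0 0 (-1) (k-N+c) (by linarith)
    (fun l hl => by have := hQC l hl; simp only [GRC, GR_s0, GR_s1, GR_s2, GR_s3] at *; omega)]
  rw [GR_prodQ a b c d k ha hb hc hd Q _ 0 0 (-1) 0 (k-N+d) (by linarith)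
    (fun l hl => by have := hQC l hl; simp only [GRC, GR_s0, GR_s1, GR_s2, GR_s3] at *; omega)]
  rw [← Finset.prod_const, Finset.prod_filter]
  have hz : y0 / (1 + y0) ≠ 0 := div_ne_zero h0 h1
  generalize y0 / (1 + y0) = z at *
  generalize 1 + y0 = o at *
  simp only [neg_zero, neg_neg]
  have main : ∀ v ∈ GRP a b c d k k,
      (if GRs 0 (-1) 0 0 v ∈ Q ∧ GRs (-1) 0 0 0 v ∈ Q then o else 1) *
      (if v 2 < 0 ∧ v 3 < 0 ∧ (GRs 0 0 0 1 v ∈ Q ∨ GRs 0 0 1 0 v ∈ Q) then z else 1) =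
      (if v 2 = 0 ∧ v 3 = 0 then z else 1) *
      (((if GRs 0 (-1) 0 0 v ∈ Q then o else 1) * (if GRs (-1) 0 0 0 v ∈ Q then o else 1) *
      (if GRs 0 0 0 1 v ∈ Q then z else 1) * (if GRs 0 0 1 0 v ∈ Q then z else 1)) *
      ((if GRs (-1) 0 0 0 v ∈ Q ∨ GRs 0 (-1) 0 0 v ∈ Q then o⁻¹ else 1) *
      (if (v 2 < 0 → GRs 0 0 1 0 v ∈ Q) ∧ (v 3 < 0 → GRs 0 0 0 1 v ∈ Q) then z⁻¹ else 1))) := by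
    intro v hv
    have hvC := ((mem _ _ _).1 hv).2.2
    have q2 : GRs 0 0 1 0 v ∈ Q → v 2 < 0 := fun h => by
      have := hQC _ h; simp only [GRC, GR_s0, GR_s1, GR_s2, GR_s3] at *; omega
    have q3 : GRs 0 0 0 1 v ∈ Q → v 3 < 0 := fun h => by
      have := hQC _ h; simp only [GRC, GR_s0, GR_s1, GR_s2, GR_s3] at *; omega
    have A : (if GRs 0 (-1) 0 0 v ∈ Q ∧ GRs (-1) 0 0 0 v ∈ Q then o else 1) =
      (if GRs 0 (-1) 0 0 v ∈ Q then o else 1) * (if GRs (-1) 0 0 0 v ∈ Q then o else 1) *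
      (if GRs (-1) 0 0 0 v ∈ Q ∨ GRs 0 (-1) 0 0 v ∈ Q then o⁻¹ else 1) := by
      by_cases p1 : GRs 0 (-1) 0 0 v ∈ Q <;> by_cases p2 : GRs (-1) 0 0 0 v ∈ Q <;>
        simp [p1, p2, h1]
    have B : (if v 2 < 0 ∧ v 3 < 0 ∧ (GRs 0 0 0 1 v ∈ Q ∨ GRs 0 0 1 0 v ∈ Q) then z else 1) =
      (if v 2 = 0 ∧ v 3 = 0 then z else 1) *
      ((if GRs 0 0 0 1 v ∈ Q then z else 1) * (if GRs 0 0 1 0 v ∈ Q then z else 1) *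
      (if (v 2 < 0 → GRs 0 0 1 0 v ∈ Q) ∧ (v 3 < 0 → GRs 0 0 0 1 v ∈ Q) then z⁻¹ else 1)) := by
      have t2 : (v 2 < 0 ∧ v 2 ≠ 0) ∨ (¬ v 2 < 0 ∧ v 2 = 0) := by unfold GRC at hvC; omega
      have t3 : (v 3 < 0 ∧ v 3 ≠ 0) ∨ (¬ v 3 < 0 ∧ v 3 = 0) := by unfold GRC at hvC; omega
      by_cases p1 : GRs 0 0 0 1 v ∈ Q <;> by_cases p2 : GRs 0 0 1 0 v ∈ Q <;>
        rcases t2 with ⟨t2, t2'⟩ | ⟨t2, t2'⟩ <;> rcases t3 with ⟨t3, t3'⟩ | ⟨t3, t3'⟩ <;>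
        simp [p1, p2, t2, t3, t2', t3', hz] at q2 q3 ⊢
    rw [A, B]; ring
  have main' := Finset.prod_congr (rfl : GRP a b c d k k = _) main
  simp only [Finset.prod_mul_distrib] at main'
  rw [main']
  ring

open Classical in
theorem GR_step (ha : 0 < a) (hb : 0 < b) (hc : 0 < c) (hd : 0 < d) (hab : a + b = N)
    (hcd : c + d = N) (y y' : ℤ → ℚ)
    (h0 : y (k - N) ≠ 0) (h1 : 1 + y (k-N) ≠ 0) (hyk : y' k = (y (k-N))⁻¹)
    (hy : ∀ s, k - N + 1 ≤ s → s ≤ k - 1 → y' s = y s *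
      ((if s = k - N + a then 1 + y (k-N) else 1) *
      (if s = k - N + b then 1 + y (k-N) else 1) *
      (if s = k - N + c then y (k-N) / (1 + y (k-N)) else 1) *
      (if s = k - N + d then y (k-N) / (1 + y (k-N)) else 1))) :
    GRZ (GRP a b c d (k-N) (k-1)) (fun l => y (linS a b c d l)) =
    (y (k-N) / (1 + y (k-N))) ^ ((GRP a b c d k k).filter (fun v => v 2 = 0 ∧ v 3 = 0)).card *
    GRZ (GRP a b c d (k-N+1) k) (fun l => y' (linS a b c d l)) := by
  have mem := fun lo hi => GR_mem a b c d lo hi ha hb hc hd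
  have u1 : GRP a b c d (k-N) (k-1) = GRP a b c d (k-N+1) (k-1) ∪ GRP a b c d (k-N) (k-N) := by
    ext l; simp only [Finset.mem_union, mem]; unfold GRC; omega
  have u2 : GRP a b c d (k-N+1) k = GRP a b c d (k-N+1) (k-1) ∪ GRP a b c d k k := by
    ext l; simp only [Finset.mem_union, mem]; unfold GRC; omega
  rw [u1, u2, GR_Z_union, GR_Z_union, Finset.mul_sum]
  · refine Finset.sum_congr rfl fun Q hQ => ?_
    rw [Finset.mem_powerset] at hQ
    split_ifs with hF
    · exact GR_local a b c d N k ha hb hc hd hab hcd Q hQ hF y y' h0 h1 hyk hy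
    · simp
  · rw [Finset.disjoint_left]; intro l; simp only [mem]; omega
  · intro v hv w hw hvw hne
    have hL : linS a b c d v ≤ linS a b c d w := by simp only [mem] at hv hw; omega
    rcases GR_up' a b c d hc hd v w hvw hne hL with h | h
    · refine ⟨_, ?_, h, ?_⟩ <;>
      simp only [mem, GR_lin_s, GRC, GR_le, GR_s0, GR_s1, GR_s2, GR_s3] at * <;> omega
    · refine ⟨_, ?_, h, ?_⟩ <;>
      simp only [mem, GR_lin_s, GRC, GR_le, GR_s0, GR_s1, GR_s2, GR_s3] at * <;> omega
  · rw [Finset.disjoint_left]; intro l; simp only [mem]; omega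
  · intro v hv w hw hvw hne
    have hL : linS a b c d v ≤ linS a b c d w := by simp only [mem] at hv hw; omega
    rcases GR_up a b c d hc hd v w hvw hne hL with h | h
    · refine ⟨_, ?_, ?_, h⟩ <;>
      simp only [mem, GR_lin_s, GRC, GR_le, GR_s0, GR_s1, GR_s2, GR_s3] at * <;> omega
    · refine ⟨_, ?_, ?_, h⟩ <;>
      simp only [mem, GR_lin_s, GRC, GR_le, GR_s0, GR_s1, GR_s2, GR_s3] at * <;> omega
end GRstep

section GRfinal
variable (a b c d N : ℤ) (x : ℤ → ℚ)

/-- exchange ratio -/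
def GRrho (u : ℤ) : ℚ := x (u + a) * x (u + b) / (x (u + c) * x (u + d))
/-- one plus the exchange ratio -/
def GRo (u : ℤ) : ℚ := x u * x (u + N) / (x (u + c) * x (u + d))
/-- the quotient of the two -/
def GRz (u : ℤ) : ℚ := x (u + a) * x (u + b) / (x u * x (u + N))

/-- the y-variables in the seed t -/
def GRY (t s : ℤ) : ℚ := (GRrho a b c d x s)⁻¹ *
  ((if s + b < t then GRo c d N x (s + b) else 1) * (if s + a < t then GRo c d N x (s + a) else 1) *
   (if s + d < t then GRz a b N x (s + d) else 1) * (if s + c < t then GRz a b N x (s + c) else 1))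

theorem GR_core (hab : a + b = N) (hcd : c + d = N) (hnz : ∀ i, x i ≠ 0) (s : ℤ) :
    (GRrho a b c d x s)⁻¹ * (GRo c d N x (s + b) * GRo c d N x (s + a) *
      GRz a b N x (s + d) * GRz a b N x (s + c)) = GRrho a b c d x (s + N) := by
  unfold GRrho GRo GRz
  have e1 : s + d + a = s + a + d := by ring
  have e2 : s + d + b = s + b + d := by ring
  have e3 : s + c + a = s + a + c := by ring
  have e4 : s + c + b = s + b + c := by ring
  have e5 : s + N + a = s + a + N := by ring
  have e6 : s + N + b = s + b + N := by ring
  have e7 : s + N + c = s + c + N := by ring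
  have e8 : s + N + d = s + d + N := by ring
  rw [e1, e2, e3, e4, e5, e6, e7, e8]
  have := hnz
  field_simp [hnz]

theorem GR_tele (h : ℕ → ℕ → ℚ) (hh : ∀ i j, h i j ≠ 0) (M M' : ℕ) :
    ∏ i ∈ Finset.range M, ∏ j ∈ Finset.range M',
      (h (i+1) j * h i (j+1) / (h i j * h (i+1) (j+1))) =
      h M 0 * h 0 M' / (h 0 0 * h M M') := by
  have inner : ∀ i, ∏ j ∈ Finset.range M',
      (h (i+1) j * h i (j+1) / (h i j * h (i+1) (j+1))) =
      h (i+1) 0 * h i M' / (h i 0 * h (i+1) M') := by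
    intro i
    induction M' with
    | zero => simp [mul_comm, hh]
    | succ n ih => rw [Finset.prod_range_succ, ih]; field_simp [hh]
  simp only [inner]
  induction M with
  | zero => simp [hh]
  | succ n ih => rw [Finset.prod_range_succ, ih]; field_simp [hh]

open Classical in
theorem GR_prodz (ha : 0 < a) (hb : 0 < b) (hc : 0 < c) (hd : 0 < d) (hab : a + b = N)
    (hinit : ∀ i : ℤ, 1 ≤ i → i ≤ N → x i = 1)
    (hnz : ∀ i : ℤ, x i ≠ 0) (n : ℕ) (hn : 0 < n) :
    ∏ i ∈ Finset.range n, GRz a b N x (1 - n + i) ^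
      ((GRP a b c d i i).filter (fun v => v 2 = 0 ∧ v 3 = 0)).card = (x (1 - n))⁻¹ := by
  set w : ℤ → ℚ := fun t => if t ≤ 0 then x t else 1 with hw
  have hwnz : ∀ t, w t ≠ 0 := by
    intro t; simp only [hw]; split_ifs
    · exact hnz t
    · exact one_ne_zero
  have hwx : ∀ t, t ≤ N → w t = x t := by
    intro t ht; simp only [hw]; split_ifs with h
    · rfl
    · exact (hinit t (by omega) ht).symm
  have hw1 : ∀ t, 0 < t → w t = 1 := by
    intro t ht; simp only [hw]; rw [if_neg (by omega)]
  have tele := GR_tele (fun i j => w (1 - n + a * i + b * j)) (fun i j => hwnz _) n n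
  have hnn : (n : ℤ) ≤ a * n := by nlinarith
  have hnb : (n : ℤ) ≤ b * n := by nlinarith
  simp only [Nat.cast_zero, mul_zero, add_zero] at tele
  rw [hw1 (1 - n + a * n) (by omega), hw1 (1 - n + b * n) (by omega),
    hw1 (1 - n + a * n + b * n) (by omega), hwx (1 - n) (by omega)] at tele
  rw [mul_one, mul_one, one_div] at tele
  rw [← tele, ← Finset.prod_product']
  have hcard : ∀ i ∈ Finset.range n,
      ((GRP a b c d i i).filter (fun v => v 2 = 0 ∧ v 3 = 0)).card =
      ((Finset.range n ×ˢ Finset.range n).filter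
        (fun p : ℕ × ℕ => a * p.1 + b * p.2 = (i : ℤ))).card := by
    intro i hi
    rw [Finset.mem_range] at hi
    refine Finset.card_bij' (fun v _ => ((v 0).toNat, (v 1).toNat))
      (fun p _ => ![(p.1 : ℤ), (p.2 : ℤ), 0, 0]) ?_ ?_ ?_ ?_
    · intro v hv
      rw [Finset.mem_filter, GR_mem a b c d _ _ ha hb hc hd] at hv
      obtain ⟨⟨h1, h2, h3, h4, -⟩, h5, h6⟩ := hv
      simp only [linS, h5, h6] at h1 h2
      have k0 : v 0 ≤ a * v 0 := by nlinarith
      have k1 : v 1 ≤ b * v 1 := by nlinarith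
      simp only [Finset.mem_filter, Finset.mem_product, Finset.mem_range]
      rw [Int.toNat_of_nonneg h3, Int.toNat_of_nonneg h4]
      refine ⟨⟨?_, ?_⟩, ?_⟩ <;> omega
    · intro p hp
      simp only [Finset.mem_filter, Finset.mem_product, Finset.mem_range] at hp
      rw [Finset.mem_filter, GR_mem a b c d _ _ ha hb hc hd]
      simp [linS, GRC, hp.2]
    · intro v hv
      rw [Finset.mem_filter, GR_mem a b c d _ _ ha hb hc hd] at hv
      obtain ⟨⟨h1, h2, h3, h4, -⟩, h5, h6⟩ := hv
      rw [GR_ext]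
      simp [h3, h4, h5, h6]
    · intro p hp
      simp
  rw [Finset.prod_congr rfl (fun i hi => by rw [hcard i hi])]
  simp only [← Finset.prod_const, Finset.prod_filter]
  rw [Finset.prod_comm]
  refine Finset.prod_congr rfl ?_
  rintro ⟨m1, m2⟩ hm
  simp only
  push_cast
  have hp1 : 0 ≤ a * (m1:ℤ) := by positivity
  have hp2 : 0 ≤ b * (m2:ℤ) := by positivity
  have f1 : 1 - (n:ℤ) + a * (m1 + 1) + b * m2 = 1 - n + a * m1 + b * m2 + a := by ring
  have f2 : 1 - (n:ℤ) + a * m1 + b * (m2 + 1) = 1 - n + a * m1 + b * m2 + b := by ring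
  have f3 : 1 - (n:ℤ) + a * (m1 + 1) + b * (m2 + 1) = 1 - n + a * m1 + b * m2 + N := by
    rw [← hab]; ring
  rw [f1, f2, f3]
  by_cases hlt : a * (m1:ℤ) + b * m2 < n
  · rw [Finset.prod_eq_single (a * (m1:ℤ) + b * m2).toNat]
    · rw [Int.toNat_of_nonneg (by omega), if_pos rfl, hwx _ (by omega), hwx _ (by omega),
        hwx _ (by omega), hwx _ (by omega)]
      unfold GRz
      simp only [← add_assoc]
    · intro i hi hne
      rw [if_neg]
      omega
    · intro h
      rw [Finset.mem_range] at h
      omega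
  · rw [Finset.prod_eq_one, hw1 _ (by omega), hw1 _ (by omega), hw1 _ (by omega), hw1 _ (by omega)]
    · simp
    · intro i hi
      rw [Finset.mem_range] at hi
      rw [if_neg]
      omega

theorem GR_Yfinal (ha : 0 < a) (hb : 0 < b) (hc : 0 < c) (hd : 0 < d) (hab : a + b = N)
    (hcd : c + d = N)
    (hinit : ∀ i : ℤ, 1 ≤ i → i ≤ N → x i = 1)
    (hnz : ∀ i : ℤ, x i ≠ 0) (s : ℤ) (hs1 : 1 - N ≤ s) (hs2 : s ≤ 0) :
    GRY a b c d N x 1 s = 1 := by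
  set w : ℤ → ℚ := fun t => if t ≤ 0 then x t else 1 with hw
  have hwnz : ∀ t, w t ≠ 0 := by
    intro t; simp only [hw]; split_ifs
    · exact hnz t
    · exact one_ne_zero
  have hwx : ∀ t, t ≤ N → x t = w t := by
    intro t ht; simp only [hw]; split_ifs with h
    · rfl
    · exact (hinit t (by omega) ht)
  have hw1 : ∀ t, 0 < t → w t = 1 := by
    intro t ht; simp only [hw]; rw [if_neg (by omega)]
  have core := GR_core a b c d N w hab hcd hwnz s
  have hr : GRrho a b c d w (s + N) = 1 := by
    unfold GRrho
    rw [hw1 _ (by omega), hw1 _ (by omega), hw1 _ (by omega), hw1 _ (by omega)]; simp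
  rw [hr] at core
  rw [← core]
  have o : ∀ u, (if u < 1 then GRo c d N x u else 1) = GRo c d N w u := by
    intro u
    unfold GRo
    split_ifs with h
    · rw [hwx _ (by omega), hwx _ (by omega), hwx _ (by omega), hwx _ (by omega)]
    · rw [hw1 _ (by omega), hw1 _ (by omega), hw1 _ (by omega), hw1 _ (by omega)]; simp
  have z : ∀ u, (if u < 1 then GRz a b N x u else 1) = GRz a b N w u := by
    intro u
    unfold GRz
    split_ifs with h
    · rw [hwx _ (by omega), hwx _ (by omega), hwx _ (by omega), hwx _ (by omega)]
    · rw [hw1 _ (by omega), hw1 _ (by omega), hw1 _ (by omega), hw1 _ (by omega)]; simp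
  have r : GRrho a b c d x s = GRrho a b c d w s := by
    unfold GRrho
    rw [hwx _ (by omega), hwx _ (by omega), hwx _ (by omega), hwx _ (by omega)]
  unfold GRY
  rw [o, o, z, z, r]

theorem GR_Ystep (t s : ℤ) (S T : ℤ → ℚ) (hS : ∀ u, GRo c d N x u = S u)
    (hT : ∀ u, GRz a b N x u = T u) :
    GRY a b c d N x (t + 1) s = GRY a b c d N x t s *
      ((if s + b = t then S t else 1) * (if s + a = t then S t else 1) *
       (if s + d = t then T t else 1) * (if s + c = t then T t else 1)) := by
  have key : ∀ (f : ℤ → ℚ) (u : ℤ), (if u < t + 1 then f u else 1) =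
      (if u < t then f u else 1) * (if u = t then f t else 1) := by
    intro f u
    rcases lt_trichotomy u t with h | h | h
    · rw [if_pos (by omega), if_pos h, if_neg (by omega), mul_one]
    · subst h; simp
    · rw [if_neg (by omega), if_neg (by omega), if_neg (by omega), mul_one]
  unfold GRY
  simp only [hS, hT, key]
  ring

open Classical in
theorem GR_main (ha : 0 < a) (hb : 0 < b) (hc : 0 < c) (hd : 0 < d) (hab : a + b = N)
    (hcd : c + d = N) (hnz : ∀ i : ℤ, x i ≠ 0)
    (hrec : ∀ i : ℤ, x i * x (i + N) = x (i + a) * x (i + N - a) + x (i + c) * x (i + N - c))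
    (p : ℤ) (n : ℕ) :
    1 = (∏ i ∈ Finset.range n, GRz a b N x (p + i) ^
      ((GRP a b c d i i).filter (fun v => v 2 = 0 ∧ v 3 = 0)).card) *
      GRZ (GRP a b c d (n - N) (n - 1)) (fun l => GRY a b c d N x (p + n) (p + linS a b c d l)) := by
  have ho : ∀ u, GRo c d N x u = 1 + GRrho a b c d x u := by
    intro u
    unfold GRo GRrho
    rw [hrec, show u + N - a = u + b by omega, show u + N - c = u + d by omega]
    field_simp [hnz]
    ring
  have honz : ∀ u, GRo c d N x u ≠ 0 := by
    intro u; unfold GRo; simp [hnz]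
  have hrnz : ∀ u, GRrho a b c d x u ≠ 0 := by
    intro u; unfold GRrho; simp [hnz]
  have hz : ∀ u, GRz a b N x u = GRrho a b c d x u / (1 + GRrho a b c d x u) := by
    intro u
    rw [← ho]
    unfold GRz GRo GRrho
    field_simp [hnz]
  induction n with
  | zero =>
    have : GRP a b c d ((0:ℕ) - N) ((0:ℕ) - 1) = ∅ := by
      rw [Finset.eq_empty_iff_forall_notMem]
      intro l hl
      rw [GR_mem a b c d _ _ ha hb hc hd] at hl
      obtain ⟨-, h, h0, h1, h2, h3⟩ := hl
      unfold linS at h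
      push_cast at h
      have := mul_nonneg ha.le h0
      have := mul_nonneg hb.le h1
      have := mul_nonpos_of_nonneg_of_nonpos hc.le h2
      have := mul_nonpos_of_nonneg_of_nonpos hd.le h3
      linarith
    rw [this]
    simp [GRZ, GRIsF]
  | succ n ih =>
    have hrho : GRY a b c d N x (p + n) (p + (n - N)) = GRrho a b c d x (p + n) := by
      unfold GRY
      rw [if_pos (by omega), if_pos (by omega), if_pos (by omega), if_pos (by omega),
        GR_core a b c d N x hab hcd hnz]
      congr 1; ring
    have st := GR_step a b c d N n ha hb hc hd hab hcd
      (fun s => GRY a b c d N x (p + n) (p + s)) (fun s => GRY a b c d N x (p + n + 1) (p + s))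
      (by rw [hrho]; exact hrnz _) (by rw [hrho, ← ho]; exact honz _)
      (by
        rw [hrho]; unfold GRY
        rw [if_neg (by omega), if_neg (by omega), if_neg (by omega), if_neg (by omega)]; simp)
      (by
        intro s hs1 hs2
        rw [hrho, GR_Ystep a b c d N x (p + n) (p + s) _ _ ho hz]
        have q1 : (p + s + b = p + n) = (s = n - N + a) := by apply propext; omega
        have q2 : (p + s + a = p + n) = (s = n - N + b) := by apply propext; omega
        have q3 : (p + s + d = p + n) = (s = n - N + c) := by apply propext; omega
        have q4 : (p + s + c = p + n) = (s = n - N + d) := by apply propext; omega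
        simp only [q1, q2, q3, q4])
    rw [hrho, ← hz] at st
    rw [st] at ih
    rw [Finset.prod_range_succ, mul_assoc]
    push_cast
    rw [show (n:ℤ) + 1 - N = n - N + 1 by ring, show (n:ℤ) + 1 - 1 = n by ring, ← add_assoc]
    exact ih

open Classical in
theorem GR_card (ha : 0 < a) (hb : 0 < b) (hc : 0 < c) (hd : 0 < d) (j : ℤ) :
    GRZ (GRP a b c d (j - N) (j - 1)) (fun _ => 1) =
    (Nat.card {R : Set V4 // R ⊆ Sj a b c d N j ∧
        ∀ l ∈ R, ∀ m ∈ Sj a b c d N j, l ≤ m → m ∈ R} : ℚ) := by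
  have hP : (GRP a b c d (j - N) (j - 1) : Set V4) = Sj a b c d N j := by
    ext l
    rw [Finset.mem_coe, GR_mem a b c d _ _ ha hb hc hd]
    rfl
  rw [← hP]
  generalize GRP a b c d (j - N) (j - 1) = P
  unfold GRZ
  simp only [Finset.prod_const_one]
  rw [← Finset.sum_filter, Finset.sum_const, nsmul_eq_mul, mul_one]
  congr 1
  rw [← Nat.card_eq_finsetCard]
  refine Nat.card_congr ⟨fun R => ⟨(R.1 : Set V4), ?_⟩, fun R => ⟨P.filter (fun l => l ∈ R.1), ?_⟩, ?_, ?_⟩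
  · have h := R.2
    rw [Finset.mem_filter, Finset.mem_powerset] at h
    exact ⟨fun l hl => h.1 hl, fun l hl m hm hlm => h.2 l hl m hm hlm⟩
  · rw [Finset.mem_filter, Finset.mem_powerset]
    refine ⟨Finset.filter_subset _ _, ?_⟩
    intro l hl m hm hlm
    rw [Finset.mem_filter] at hl ⊢
    exact ⟨hm, R.2.2 l hl.2 m hm hlm⟩
  · rintro ⟨R, hR⟩
    rw [Finset.mem_filter, Finset.mem_powerset] at hR
    apply Subtype.ext
    ext l
    have := @hR.1 l
    simp only [Finset.mem_filter, Finset.mem_coe]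
    tauto
  · rintro ⟨R, hR⟩
    apply Subtype.ext
    ext l
    have := @hR.1 l
    simp only [Finset.mem_coe, Finset.mem_filter] at *
    tauto
end GRfinal

/-- Let `a+b = N = c+d` with `gcd(a,c,N) = 1` and `{a,b} ≠ {c,d}`, and
let `x : ℤ → ℚ` be a nowhere-zero sequence with `x_i = 1` for `1 ≤ i ≤ N` satisfying the
Gale–Robinson recurrence.  Then for every `j > 0`, `x_{1−j}` equals the number of order
filters of the finite poset `S^{(j)}`. -/
theorem galeRobinson_eq_card_orderFilters (a b c d N : ℤ)
    (ha : 0 < a) (hb : 0 < b) (hc : 0 < c) (hd : 0 < d)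
    (hab : a + b = N) (hcd : c + d = N)
    (hgcd : Int.gcd a (Int.gcd c N) = 1)
    (hne : ({a, b} : Set ℤ) ≠ ({c, d} : Set ℤ))
    (x : ℤ → ℚ)
    (hinit : ∀ i : ℤ, 1 ≤ i → i ≤ N → x i = 1)
    (hnz : ∀ i : ℤ, x i ≠ 0)
    (hrec : ∀ i : ℤ, x i * x (i + N) = x (i + a) * x (i + N - a) + x (i + c) * x (i + N - c))
    (j : ℤ) (hj : 0 < j) :
    x (1 - j) =
      (Nat.card {R : Set V4 // R ⊆ Sj a b c d N j ∧
        ∀ l ∈ R, ∀ m ∈ Sj a b c d N j, l ≤ m → m ∈ R} : ℚ) := by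
  have hj' : ((j.toNat : ℕ) : ℤ) = j := Int.toNat_of_nonneg hj.le
  have main := GR_main a b c d N x ha hb hc hd hab hcd hnz hrec (1 - j) j.toNat
  have pz := GR_prodz a b c d N x ha hb hc hd hab hinit hnz j.toNat (by omega)
  rw [hj'] at main pz
  rw [pz] at main
  have hZ : GRZ (GRP a b c d (j - N) (j - 1))
      (fun l => GRY a b c d N x (1 - j + j) (1 - j + linS a b c d l)) =
      GRZ (GRP a b c d (j - N) (j - 1)) (fun _ => 1) := by
    unfold GRZ
    refine Finset.sum_congr rfl fun R hR => ?_
    rw [Finset.mem_powerset] at hR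
    congr 1
    refine Finset.prod_congr rfl fun l hl => ?_
    have := (GR_mem a b c d _ _ ha hb hc hd l).1 (hR hl)
    rw [show 1 - j + j = 1 by ring]
    exact GR_Yfinal a b c d N x ha hb hc hd hab hcd hinit hnz _ (by omega) (by omega)
  rw [hZ, GR_card a b c d N ha hb hc hd j] at main
  have hx := hnz (1 - j)
  field_simp at main
  exact main
end

section
/- Let a, b, c, d be positive integers with a + b = N and c + d = N. For every integer j > 0, the set S^{(j)} is finite, is closed under intervals in X_{j−N−1}, and is sturdy as a subset of X_{j−N−1}. -/
/-- `S ⊆ X_t` is sturdy: for each `λ` with `a·λ₁ + b·λ₂ − c·λ₃ − d·λ₄ = t+1`,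
`λ + (1,0,0,0) ∈ S` and `λ + (0,1,0,0) ∈ S` imply `λ ∈ S`, and `λ − (0,0,1,0) ∈ S` and
`λ − (0,0,0,1) ∈ S` imply `λ ∈ S`. -/
def Sturdy (a b c d t : ℤ) (S : Set V4) : Prop :=
  ∀ l : V4, linS a b c d l = t + 1 →
    ((l + ![1, 0, 0, 0] ∈ S → l + ![0, 1, 0, 0] ∈ S → l ∈ S) ∧
     (l - ![0, 0, 1, 0] ∈ S → l - ![0, 0, 0, 1] ∈ S → l ∈ S))

/-- For every `j > 0`, the set `S^{(j)}` is finite, closed under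
intervals in `X_{j−N−1}`, and sturdy as a subset of `X_{j−N−1}`. -/
theorem Sj_finite_intervalClosed_sturdy (a b c d N : ℤ)
    (ha : 0 < a) (hb : 0 < b) (hc : 0 < c) (hd : 0 < d)
    (hab : a + b = N) (hcd : c + d = N)
    (j : ℤ) (hj : 0 < j) :
    (Sj a b c d N j).Finite ∧
      IntervalClosed a b c d N (j - N - 1) (Sj a b c d N j) ∧
      Sturdy a b c d (j - N - 1) (Sj a b c d N j) := by
  refine ⟨?_, ?_, ?_⟩
  · apply (Set.finite_Icc (![0, 0, -j, -j] : V4) ![j, j, 0, 0]).subset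
    rintro l ⟨_, h2, h3, h4, h5, h6⟩
    unfold linS at h2
    have e0 : l 0 ≤ a * l 0 := by nlinarith
    have e1 : l 1 ≤ b * l 1 := by nlinarith
    have e2 : c * l 2 ≤ l 2 := by nlinarith
    have e3 : d * l 3 ≤ l 3 := by nlinarith
    constructor
    · intro i
      fin_cases i <;> simp <;> linarith
    · intro i
      fin_cases i <;> simp <;> linarith
  · rintro x ⟨_, _, x0, x1, _, _⟩ z ⟨_, _, _, _, z2, z3⟩ y ⟨y1, y2⟩ hxy hyz
    exact ⟨by linarith, by linarith, x0.trans (hxy 0), x1.trans (hxy 1),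
      (hyz 2).trans z2, (hyz 3).trans z3⟩
  · intro l hl
    constructor
    · rintro ⟨_, _, p0, p1, p2, p3⟩ ⟨_, _, q0, q1, q2, q3⟩
      simp at p0 p1 p2 p3 q0 q1 q2 q3
      exact ⟨by linarith, by linarith, q0, p1, p2, p3⟩
    · rintro ⟨_, _, p0, p1, p2, p3⟩ ⟨_, _, q0, q1, q2, q3⟩
      simp at p0 p1 p2 p3 q0 q1 q2 q3
      exact ⟨by linarith, by linarith, p0, p1, q2, p3⟩
end

section
/- Let a, b, c, d be positive integers with a + b = N and c + d = N. For every integer j ≥ 1 and every λ ∈ ℤ⁴ with a·λ₁ + b·λ₂ − c·λ₃ − d·λ₄ = j, one has λ ∈ S^{(j+1)} if and only if at least one of the six vectors λ − (1,1,0,0), λ − (0,1,0,0), λ − (1,0,0,0), λ + (0,0,1,0), λ + (0,0,0,1), λ + (0,0,1,1) belongs to S^{(j)}. -/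
/-- For `j ≥ 1` and `λ ∈ ℤ⁴` with `a·λ₁ + b·λ₂ − c·λ₃ − d·λ₄ = j`,
one has `λ ∈ S^{(j+1)}` iff at least one of the six vectors `λ − (1,1,0,0)`,
`λ − (0,1,0,0)`, `λ − (1,0,0,0)`, `λ + (0,0,1,0)`, `λ + (0,0,0,1)`, `λ + (0,0,1,1)`
belongs to `S^{(j)}`. -/
theorem mem_Sj_succ_iff (a b c d N : ℤ)
    (ha : 0 < a) (hb : 0 < b) (hc : 0 < c) (hd : 0 < d)
    (hab : a + b = N) (hcd : c + d = N)
    (j : ℤ) (hj : 1 ≤ j) (l : V4) (hl : linS a b c d l = j) :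
    l ∈ Sj a b c d N (j + 1) ↔
      (l - ![1, 1, 0, 0] ∈ Sj a b c d N j ∨
       l - ![0, 1, 0, 0] ∈ Sj a b c d N j ∨
       l - ![1, 0, 0, 0] ∈ Sj a b c d N j ∨
       l + ![0, 0, 1, 0] ∈ Sj a b c d N j ∨
       l + ![0, 0, 0, 1] ∈ Sj a b c d N j ∨
       l + ![0, 0, 1, 1] ∈ Sj a b c d N j) := by
  have e1 : ∀ x : V4, x ∈ Sj a b c d N j ↔ (j - N ≤ linS a b c d x ∧ linS a b c d x ≤ j - 1 ∧
       0 ≤ x 0 ∧ 0 ≤ x 1 ∧ x 2 ≤ 0 ∧ x 3 ≤ 0) := fun x => Iff.rfl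
  have e2 : l ∈ Sj a b c d N (j + 1) ↔ (0 ≤ l 0 ∧ 0 ≤ l 1 ∧ l 2 ≤ 0 ∧ l 3 ≤ 0) := by
    constructor
    · rintro ⟨_, _, h⟩
      exact h
    · intro h
      exact ⟨by omega, by omega, h⟩
  rw [e2]
  simp only [e1]
  unfold linS at *
  simp
  generalize l 0 = p at *
  generalize l 1 = q at *
  generalize l 2 = r at *
  generalize l 3 = s at *
  simp only [mul_sub, mul_add, mul_one]
  constructor
  · rintro ⟨h0, h1, h2, h3⟩
    by_cases k0 : 1 ≤ p
    · right; right; left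
      omega
    by_cases k1 : 1 ≤ q
    · right; left
      omega
    by_cases k2 : r ≤ -1
    · right; right; right; left
      omega
    by_cases k3 : s ≤ -1
    · right; right; right; right; left
      omega
    obtain rfl : p = 0 := by omega
    obtain rfl : q = 0 := by omega
    obtain rfl : r = 0 := by omega
    obtain rfl : s = 0 := by omega
    simp at hl
    omega
  · omega
end
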